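/- arXiv:2511.21144 — 3 statements merged into one kernel-verified Lean document; each statement's English description precedes it below -/
import Mathlib

section
/- For all integers k ≥ 3 and g ≥ 3, f(k,g) ≤ n(k,g)/g. -/
/-- A graph is `k`-regular: every vertex has exactly `k` neighbours. -/
def IsRegular' (k : ℕ) {V : Type*} (G : SimpleGraph V) : Prop :=
  ∀ v : V, (G.neighborSet v).ncard = k

/-- A `(k; g, d)`-graph: a `k`-regular simple graph of girth exactly `g` and
diameter exactly `d`. -/
def IsKGDGraph (k g d : ℕ) {V : Type*} (G : SimpleGraph V) : Prop :=
  IsRegular' k G ∧ G.egirth = g ∧ G.ediam = d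

/-- `n(k, g)`: the minimum order of a finite `k`-regular simple graph of girth exactly `g`. -/
noncomputable def cageOrder (k g : ℕ) : ℕ :=
  sInf {n : ℕ | ∃ G : SimpleGraph (Fin n), IsRegular' k G ∧ G.egirth = g}

/-- `f(k,g)`: the infimum of all real `c` for which there is a constant `C` such that
for every sufficiently large `d` there is a `(k; g, d)`-graph with at most `c·d + C`
vertices. -/
noncomputable def fRatio (k g : ℕ) : ℝ :=
  sInf {c : ℝ | ∃ C : ℝ, ∃ d₀ : ℕ, ∀ d : ℕ, d₀ ≤ d →
    ∃ n : ℕ, (n : ℝ) ≤ c * d + C ∧ ∃ G : SimpleGraph (Fin n), IsKGDGraph k g d G}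

namespace SimpleGraph

variable {V W U : Type*}

/-- A function that increases by at most one along each edge bounds walk lengths from below. -/
lemma Walk.le_add_length_of_forall_adj {G : SimpleGraph V} {f : V → ℕ}
    (hf : ∀ u v, G.Adj u v → f v ≤ f u + 1) {u v : V} (w : G.Walk u v) :
    f v ≤ f u + w.length := by
  induction w with
  | nil => simp
  | cons h p ih => have := hf _ _ h; rw [Walk.length_cons]; omega

/-- The girth is at least `g` iff every edge `xy` is bypassed only by walks of length at least
`g - 1`. -/
lemma natCast_le_egirth_iff {G : SimpleGraph V} {g : ℕ} :
    (g : ℕ∞) ≤ G.egirth ↔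
      ∀ x y, G.Adj x y → ∀ w : (G.deleteEdges {s(x, y)}).Walk x y, g ≤ w.length + 1 := by
  classical
  rw [le_egirth]
  constructor
  · intro h x y hxy w
    have hle : G.deleteEdges {s(x, y)} ≤ G := deleteEdges_le _
    have hb : (w.bypass.mapLe hle).IsPath := (w.bypass_isPath).mapLe hle
    have hc : (Walk.cons hxy.symm (w.bypass.mapLe hle)).IsCycle := by
      rw [Walk.cons_isCycle_iff]
      refine ⟨hb, fun he => ?_⟩
      rw [Walk.edges_mapLe_eq_edges] at he
      have := Walk.edges_subset_edgeSet _ he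
      simp [Sym2.eq_swap] at this
    have h1 := h _ _ hc
    have h2 := w.length_bypass_le_length
    simp only [Walk.length_cons, Nat.cast_le, Walk.length_map, Walk.mapLe] at h1
    omega
  · intro h a w hw
    cases w with
    | nil => simp at hw
    | @cons _ b _ hab p =>
      rw [Walk.cons_isCycle_iff] at hw
      have := h b a hab.symm (p.toDeleteEdges {s(b, a)} (by
        intro e he; simp only [Set.mem_singleton_iff]; rintro rfl
        exact hw.2 (by rwa [Sym2.eq_swap])))
      rw [Walk.length_transfer] at this
      simpa using mod_cast this

/-- The distance in `G` truncated at `N`. -/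
noncomputable def truncDist (G : SimpleGraph V) (N : ℕ) (u v : V) : ℕ :=
  (min (N : ℕ∞) (G.edist u v)).toNat

section truncDist

variable {G : SimpleGraph V} {N : ℕ} {u v w : V}

lemma coe_truncDist : (G.truncDist N u v : ℕ∞) = min (N : ℕ∞) (G.edist u v) :=
  ENat.natCast_toNat (ne_top_of_le_ne_top (ENat.natCast_ne_top N) (min_le_left _ _))

@[simp] lemma truncDist_self : G.truncDist N u u = 0 := by simp [truncDist]

lemma truncDist_le : G.truncDist N u v ≤ N := by
  have := (coe_truncDist (G := G) (N := N) (u := u) (v := v)).le.trans (min_le_left _ _)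
  exact_mod_cast this

lemma truncDist_le_length (p : G.Walk u v) : G.truncDist N u v ≤ p.length := by
  have := (coe_truncDist (G := G) (N := N) (u := u) (v := v)).le.trans (min_le_right _ _)
  exact_mod_cast this.trans (edist_le p)

lemma exists_walk_length_eq_truncDist (h : G.truncDist N u v < N) :
    ∃ p : G.Walk u v, p.length = G.truncDist N u v := by
  have h1 := coe_truncDist (G := G) (N := N) (u := u) (v := v)
  rcases le_total (N : ℕ∞) (G.edist u v) with h2 | h2
  · rw [min_eq_left h2] at h1
    have := Nat.cast_injective h1
    omega
  · rw [min_eq_right h2] at h1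
    exact exists_walk_of_edist_eq_coe h1.symm

lemma le_truncDist {m : ℕ} (hm : m ≤ N) (h : ∀ p : G.Walk u v, m ≤ p.length) :
    m ≤ G.truncDist N u v := by
  by_contra! hlt
  obtain ⟨p, hp⟩ := exists_walk_length_eq_truncDist (hlt.trans_le hm)
  have := h p
  omega

lemma Adj.truncDist_le (h : G.Adj v w) : G.truncDist N u w ≤ G.truncDist N u v + 1 := by
  by_contra! hlt
  have h2 : G.truncDist N u w ≤ N := SimpleGraph.truncDist_le
  obtain ⟨p, hp⟩ := exists_walk_length_eq_truncDist (show G.truncDist N u v < N by omega)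
  have := truncDist_le_length (N := N) (p.concat h)
  rw [Walk.length_concat] at this
  omega

end truncDist

/-- The disjoint union of `Y` and `X` together with the two edges `y₁p` and `y₂q`. -/
def join (Y : SimpleGraph W) (X : SimpleGraph U) (y₁ y₂ : W) (p q : U) : SimpleGraph (W ⊕ U) where
  Adj
    | .inl x, .inl y => Y.Adj x y
    | .inr u, .inr v => X.Adj u v
    | .inl x, .inr u => (x = y₁ ∧ u = p) ∨ (x = y₂ ∧ u = q)
    | .inr u, .inl x => (x = y₁ ∧ u = p) ∨ (x = y₂ ∧ u = q)
  symm := ⟨by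
    rintro (x | u) (y | v) h
    · exact Adj.symm (G := Y) h
    · exact h
    · exact h
    · exact Adj.symm (G := X) h⟩
  loopless := ⟨by
    rintro (x | u) h
    · exact Y.loopless.irrefl x h
    · exact X.loopless.irrefl u h⟩

section join

variable {Y : SimpleGraph W} {X : SimpleGraph U} {y₁ y₂ : W} {p q : U}

@[simp] lemma join_adj_inl_inl {x y : W} :
    (join Y X y₁ y₂ p q).Adj (.inl x) (.inl y) ↔ Y.Adj x y := Iff.rfl

@[simp] lemma join_adj_inr_inr {u v : U} :
    (join Y X y₁ y₂ p q).Adj (.inr u) (.inr v) ↔ X.Adj u v := Iff.rfl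

@[simp] lemma join_adj_inl_inr {x : W} {u : U} :
    (join Y X y₁ y₂ p q).Adj (.inl x) (.inr u) ↔ (x = y₁ ∧ u = p) ∨ (x = y₂ ∧ u = q) := Iff.rfl

@[simp] lemma join_adj_inr_inl {x : W} {u : U} :
    (join Y X y₁ y₂ p q).Adj (.inr u) (.inl x) ↔ (x = y₁ ∧ u = p) ∨ (x = y₂ ∧ u = q) := Iff.rfl

/-- The inclusion of the left part of a join. -/
def joinInl (Y : SimpleGraph W) (X : SimpleGraph U) (y₁ y₂ : W) (p q : U) :
    Y →g join Y X y₁ y₂ p q := ⟨Sum.inl, id⟩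

/-- The inclusion of the right part of a join. -/
def joinInr (Y : SimpleGraph W) (X : SimpleGraph U) (y₁ y₂ : W) (p q : U) :
    X →g join Y X y₁ y₂ p q := ⟨Sum.inr, id⟩

lemma join_swap : join Y X y₁ y₂ p q = join Y X y₂ y₁ q p := by
  ext (a | a) (b | b) <;> simp [or_comm]

/-- In a join, an edge of the right part is bypassed only by long walks. -/
lemma le_length_add_one_of_join_inr {g : ℕ} (hX : (g : ℕ∞) ≤ X.egirth)
    (hYX : ∀ (a : Y.Walk y₁ y₂) (b : X.Walk p q), g ≤ a.length + b.length + 2)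
    {u v : U} (huv : X.Adj u v)
    (w : ((join Y X y₁ y₂ p q).deleteEdges {s(.inr u, .inr v)}).Walk (.inr u) (.inr v)) :
    g ≤ w.length + 1 := by
  set X' := X.deleteEdges {s(u, v)}
  set d := X'.truncDist g
  set e := Y.truncDist g
  have hd0 : ∀ a, d a a = 0 := fun _ => truncDist_self
  have he0 : ∀ a, e a a = 0 := fun _ => truncDist_self
  have hα : e y₂ y₁ = e y₁ y₂ := by simp only [e, truncDist, edist_comm]
  have hdd : d p q = d q p := by simp only [d, truncDist, edist_comm]
  let f : W ⊕ U → ℕ := Sum.elim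
    (fun y => 1 + min (d u p + e y₁ y) (d u q + e y₂ y))
    (fun z => min (d u z) (min (d u p + 2 + e y₁ y₂ + d q z) (d u q + 2 + e y₁ y₂ + d p z)))
  have hf := w.le_add_length_of_forall_adj (f := f) (by
    rintro (a | a) (b | b) hab
    · have hab' : Y.Adj a b := by simpa using hab
      have h1 : e y₁ b ≤ e y₁ a + 1 := hab'.truncDist_le
      have h2 : e y₂ b ≤ e y₂ a + 1 := hab'.truncDist_le
      simp only [f, Sum.elim_inl]; omega
    · have hab' : (a = y₁ ∧ b = p) ∨ (a = y₂ ∧ b = q) := by simpa using hab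
      have := hd0 p; have := hd0 q; have := he0 y₁; have := he0 y₂
      simp only [f, Sum.elim_inl, Sum.elim_inr]
      rcases hab' with ⟨rfl, rfl⟩ | ⟨rfl, rfl⟩ <;> omega
    · have hab' : (b = y₁ ∧ a = p) ∨ (b = y₂ ∧ a = q) := by simpa using hab
      have := hd0 p; have := hd0 q; have := he0 y₁; have := he0 y₂
      simp only [f, Sum.elim_inl, Sum.elim_inr]
      rcases hab' with ⟨rfl, rfl⟩ | ⟨rfl, rfl⟩ <;> omega
    · have hab' : X'.Adj a b := by
        simpa [X', deleteEdges_adj] using hab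
      have h1 : d u b ≤ d u a + 1 := hab'.truncDist_le
      have h2 : d p b ≤ d p a + 1 := hab'.truncDist_le
      have h3 : d q b ≤ d q a + 1 := hab'.truncDist_le
      simp only [f, Sum.elim_inr]; omega)
  have hX' := natCast_le_egirth_iff.1 hX u v huv
  have h1 : g - 1 ≤ d u v := le_truncDist (by omega) fun w => by have := hX' w; omega
  have hle : X' ≤ X := deleteEdges_le _
  have key : ∀ s t, (s = p ∧ t = q ∨ s = q ∧ t = p) →
      g - 1 ≤ d u s + 2 + e y₁ y₂ + d t v := by
    intro s t hst
    by_contra! hlt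
    obtain ⟨A, hA⟩ : ∃ A : X'.Walk u s, A.length = d u s :=
      exists_walk_length_eq_truncDist (show d u s < g by omega)
    obtain ⟨B, hB⟩ : ∃ B : X'.Walk t v, B.length = d t v :=
      exists_walk_length_eq_truncDist (show d t v < g by omega)
    obtain ⟨C, hC⟩ : ∃ C : Y.Walk y₁ y₂, C.length = e y₁ y₂ :=
      exists_walk_length_eq_truncDist (show e y₁ y₂ < g by omega)
    let D : X.Walk s t := ((A.mapLe hle).reverse.append (.cons huv .nil)).append
      (B.mapLe hle).reverse
    have hD : D.length = d u s + 1 + d t v := by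
      simp [D, hA, hB]
    rcases hst with ⟨rfl, rfl⟩ | ⟨rfl, rfl⟩
    · have := hYX C D
      omega
    · have := hYX C D.reverse
      rw [Walk.length_reverse] at this
      omega
  have k1 := key p q (.inl ⟨rfl, rfl⟩)
  have k2 := key q p (.inr ⟨rfl, rfl⟩)
  have := hd0 u
  simp only [f, Sum.elim_inr] at hf
  omega

/-- In a join, the first new edge is bypassed only by long walks. -/
lemma le_length_add_one_of_join_inl_inr {g : ℕ} (hpq : p ≠ q)
    (hYX : ∀ (a : Y.Walk y₁ y₂) (b : X.Walk p q), g ≤ a.length + b.length + 2)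
    (w : ((join Y X y₁ y₂ p q).deleteEdges {s(.inl y₁, .inr p)}).Walk (.inl y₁) (.inr p)) :
    g ≤ w.length + 1 := by
  set d := X.truncDist g
  set e := Y.truncDist g
  let f : W ⊕ U → ℕ := Sum.elim (e y₁) (fun z => e y₁ y₂ + 1 + d q z)
  have hf := w.le_add_length_of_forall_adj (f := f) (by
    rintro (a | a) (b | b) hab
    · have hab' : Y.Adj a b := by simpa using hab
      exact hab'.truncDist_le
    · have hab' : a = y₂ ∧ b = q := by
        have : ((a = y₁ ∧ b = p) ∨ (a = y₂ ∧ b = q)) ∧ (a = y₁ → b ≠ p) := by simpa using hab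
        tauto
      obtain ⟨rfl, rfl⟩ := hab'
      simp [f, d]
    · have hab' : b = y₂ ∧ a = q := by
        have : ((b = y₁ ∧ a = p) ∨ (b = y₂ ∧ a = q)) ∧ (b = y₁ → a ≠ p) := by
          simpa [Sym2.eq_swap] using hab
        tauto
      obtain ⟨rfl, rfl⟩ := hab'
      simp only [f, Sum.elim_inr, Sum.elim_inl]
      omega
    · have hab' : X.Adj a b := by simpa using hab
      have h1 : d q b ≤ d q a + 1 := hab'.truncDist_le
      simp only [f, Sum.elim_inr]; omega)
  have h1 : g ≤ e y₁ y₂ + 2 + d q p := by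
    by_contra! hlt
    obtain ⟨A, hA⟩ : ∃ A : Y.Walk y₁ y₂, A.length = e y₁ y₂ :=
      exists_walk_length_eq_truncDist (show e y₁ y₂ < g by omega)
    obtain ⟨B, hB⟩ : ∃ B : X.Walk q p, B.length = d q p :=
      exists_walk_length_eq_truncDist (show d q p < g by omega)
    have := hYX A B.reverse
    rw [Walk.length_reverse] at this
    omega
  have h0 : e y₁ y₁ = 0 := truncDist_self
  simp only [f, Sum.elim_inr, Sum.elim_inl] at hf
  omega

lemma le_egirth_join {g : ℕ} (hpq : p ≠ q) (hY : (g : ℕ∞) ≤ Y.egirth) (hX : (g : ℕ∞) ≤ X.egirth)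
    (hYX : ∀ (a : Y.Walk y₁ y₂) (b : X.Walk p q), g ≤ a.length + b.length + 2) :
    (g : ℕ∞) ≤ (join Y X y₁ y₂ p q).egirth := by
  have hcross : ∀ x u, (join Y X y₁ y₂ p q).Adj (.inl x) (.inr u) →
      ∀ w : ((join Y X y₁ y₂ p q).deleteEdges {s(.inl x, .inr u)}).Walk (.inl x) (.inr u),
      g ≤ w.length + 1 := by
    rintro x u (⟨rfl, rfl⟩ | ⟨rfl, rfl⟩) w
    · exact le_length_add_one_of_join_inl_inr hpq hYX w
    · revert w
      rw [join_swap]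
      exact le_length_add_one_of_join_inl_inr hpq.symm
        (fun a b => by simpa using hYX a.reverse b.reverse)
  rw [natCast_le_egirth_iff]
  rintro (x | u) (y | v) hxy w
  · let φ : (join Y X y₁ y₂ p q).deleteEdges {s(.inl x, .inl y)} →g
        (join X Y p q y₁ y₂).deleteEdges {s(.inr x, .inr y)} := ⟨Sum.swap, by
      rintro (a | a) (b | b) hab <;> simpa [and_comm] using hab⟩
    have := le_length_add_one_of_join_inr hY (fun a b => by have := hYX b a; omega) hxy (w.map φ)
    exact this.trans_eq (congrArg (· + 1) (w.length_map φ))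
  · exact hcross x v hxy w
  · have := hcross y u hxy.symm (w.reverse.mapLe (by rw [Sym2.eq_swap]))
    simpa using this
  · exact le_length_add_one_of_join_inr hX hYX hxy w

section degree

open scoped Classical in
lemma ncard_neighborSet_join_inl [Finite W] [Finite U] (hpq : p ≠ q) (x : W) :
    ((join Y X y₁ y₂ p q).neighborSet (.inl x)).ncard =
      (Y.neighborSet x).ncard + (if x = y₁ then 1 else 0) + (if x = y₂ then 1 else 0) := by
  have h : (join Y X y₁ y₂ p q).neighborSet (.inl x) =
      Sum.inl '' Y.neighborSet x ∪ Sum.inr '' {u | (x = y₁ ∧ u = p) ∨ (x = y₂ ∧ u = q)} := by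
    ext (a | a) <;> simp
  rw [h, Set.ncard_union_eq (by
      rw [Set.disjoint_left]; rintro _ ⟨a, -, rfl⟩ ⟨b, -, hb⟩; simp at hb),
    Set.ncard_image_of_injective _ Sum.inl_injective,
    Set.ncard_image_of_injective _ Sum.inr_injective, add_assoc]
  congr 1
  by_cases h1 : x = y₁ <;> by_cases h2 : x = y₂ <;> simp only [h1, h2, true_and, false_and,
    or_false, if_true, if_false]
  · subst h1; subst h2
    simpa [Set.insert_def] using Set.ncard_pair hpq
  · subst h1; simp [h2]
  · subst h2; simp [h1]
  · simp

open scoped Classical in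
lemma ncard_neighborSet_join_inr [Finite W] [Finite U] (hpq : p ≠ q) (u : U) :
    ((join Y X y₁ y₂ p q).neighborSet (.inr u)).ncard =
      (X.neighborSet u).ncard + (if u = p then 1 else 0) + (if u = q then 1 else 0) := by
  have h : (join Y X y₁ y₂ p q).neighborSet (.inr u) =
      Sum.inr '' X.neighborSet u ∪ Sum.inl '' {x | (x = y₁ ∧ u = p) ∨ (x = y₂ ∧ u = q)} := by
    ext (a | a) <;> simp
  rw [h, Set.ncard_union_eq (by
      rw [Set.disjoint_left]; rintro _ ⟨a, -, rfl⟩ ⟨b, -, hb⟩; simp at hb),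
    Set.ncard_image_of_injective _ Sum.inl_injective,
    Set.ncard_image_of_injective _ Sum.inr_injective, add_assoc]
  congr 1
  by_cases h1 : u = p <;> by_cases h2 : u = q
  · exact absurd (h1.symm.trans h2) hpq
  · simp [h1, hpq]
  · simp [h2, hpq.symm]
  · simp [h1, h2]

open scoped Classical in
lemma ncard_neighborSet_deleteEdges_singleton [Finite V] {G : SimpleGraph V} {a b : V}
    (hab : G.Adj a b) (v : V) :
    ((G.deleteEdges {s(a, b)}).neighborSet v).ncard + (if v = a then 1 else 0) +
      (if v = b then 1 else 0) = (G.neighborSet v).ncard := by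
  have key : ∀ a b, G.Adj a b →
      ((G.deleteEdges {s(a, b)}).neighborSet a).ncard + 1 = (G.neighborSet a).ncard := by
    intro a b hab
    have h : (G.deleteEdges {s(a, b)}).neighborSet a = G.neighborSet a \ {b} := by
      ext z
      simp
      grind
    rw [h, Set.ncard_sdiff_singleton_add_one (s := G.neighborSet a) hab]
  by_cases h1 : v = a
  · subst h1
    simp [hab.ne, key _ _ hab]
  by_cases h2 : v = b
  · subst h2
    have := key _ _ hab.symm
    rw [Sym2.eq_swap] at this
    simp [hab.ne', this]
  · have h : (G.deleteEdges {s(a, b)}).neighborSet v = G.neighborSet v := by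
      ext z
      simp
      grind
    simp [h, h1, h2]

end degree

end join

section portDist

variable {V : Type*} {X : SimpleGraph V} {p q u v : V}

/-- The distance from an outside vertex adjacent to exactly `p` and `q`. -/
noncomputable def portDist (X : SimpleGraph V) (p q u : V) : ℕ :=
  (min (X.edist p u) (X.edist q u)).toNat + 1

lemma portDist_comm : X.portDist p q u = X.portDist q p u := by
  rw [portDist, portDist, min_comm]

lemma portDist_le_length_add_one (w : X.Walk p u) : X.portDist p q u ≤ w.length + 1 := by
  have h : min (X.edist p u) (X.edist q u) ≤ w.length := (min_le_left _ _).trans (edist_le w)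
  have := ENat.toNat_le_toNat h (ENat.natCast_ne_top _)
  simpa [portDist] using this

lemma portDist_le_length_add_one' (w : X.Walk q u) : X.portDist p q u ≤ w.length + 1 := by
  rw [portDist_comm]
  exact portDist_le_length_add_one w

lemma exists_walk_length_add_one_eq_portDist (h : X.Reachable p u ∨ X.Reachable q u) :
    (∃ w : X.Walk p u, w.length + 1 = X.portDist p q u) ∨
      ∃ w : X.Walk q u, w.length + 1 = X.portDist p q u := by
  have hne : min (X.edist p u) (X.edist q u) ≠ ⊤ := by
    rcases h with h | h
    · exact ne_top_of_le_ne_top (edist_ne_top_iff_reachable.2 h) (min_le_left _ _)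
    · exact ne_top_of_le_ne_top (edist_ne_top_iff_reachable.2 h) (min_le_right _ _)
  have hcoe := ENat.natCast_toNat hne
  rcases le_total (X.edist p u) (X.edist q u) with h1 | h1
  · left
    rw [min_eq_left h1] at hcoe
    obtain ⟨w, hw⟩ := exists_walk_of_edist_eq_coe hcoe.symm
    exact ⟨w, by rw [hw, portDist, min_eq_left h1]⟩
  · right
    rw [min_eq_right h1] at hcoe
    obtain ⟨w, hw⟩ := exists_walk_of_edist_eq_coe hcoe.symm
    exact ⟨w, by rw [hw, portDist, min_eq_right h1]⟩

lemma Adj.portDist_le (huv : X.Adj u v) (h : X.Reachable p u ∨ X.Reachable q u) :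
    X.portDist p q v ≤ X.portDist p q u + 1 := by
  rcases exists_walk_length_add_one_eq_portDist h with ⟨w, hw⟩ | ⟨w, hw⟩
  · have := portDist_le_length_add_one (q := q) (w.concat huv)
    rw [Walk.length_concat] at this
    omega
  · have := portDist_le_length_add_one' (p := p) (w.concat huv)
    rw [Walk.length_concat] at this
    omega

@[simp] lemma portDist_left : X.portDist p q p = 1 := by simp [portDist]

@[simp] lemma portDist_right : X.portDist p q q = 1 := by simp [portDist]

end portDist

section joinDist

variable {W U : Type*} {Y : SimpleGraph W} {X : SimpleGraph U} {r : W} {p q : U}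

lemma exists_walk_join_inr (h : ∀ u, X.Reachable p u ∨ X.Reachable q u) (u : U) :
    ∃ w : (join Y X r r p q).Walk (.inl r) (.inr u), w.length = X.portDist p q u := by
  rcases exists_walk_length_add_one_eq_portDist (h u) with ⟨w, hw⟩ | ⟨w, hw⟩
  · have ha : (join Y X r r p q).Adj (.inl r) (.inr p) := by simp
    refine ⟨.cons ha (w.map (joinInr Y X r r p q)), ?_⟩
    rw [← hw]
    exact congrArg (· + 1) (w.length_map _)
  · have ha : (join Y X r r p q).Adj (.inl r) (.inr q) := by simp
    refine ⟨.cons ha (w.map (joinInr Y X r r p q)), ?_⟩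
    rw [← hw]
    exact congrArg (· + 1) (w.length_map _)

lemma dist_join_inl_inl_le (hY : Y.Connected) (y₁ y₂ x y : W) :
    (join Y X y₁ y₂ p q).dist (.inl x) (.inl y) ≤ Y.dist x y := by
  obtain ⟨w, hw⟩ := hY.exists_walk_length_eq_dist x y
  rw [← hw]
  exact (dist_le (w.map (joinInl Y X y₁ y₂ p q))).trans_eq (w.length_map _)

lemma Connected.join (hY : Y.Connected) (h : ∀ u, X.Reachable p u ∨ X.Reachable q u)
    (y₁ y₂ : W) : (join Y X y₁ y₂ p q).Connected := by
  rw [connected_iff_exists_forall_reachable]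
  refine ⟨.inl y₁, ?_⟩
  have hl : ∀ x, (SimpleGraph.join Y X y₁ y₂ p q).Reachable (.inl y₁) (.inl x) := fun x =>
    (hY.preconnected y₁ x).map (joinInl Y X y₁ y₂ p q)
  rintro (x | u)
  · exact hl x
  · rcases h u with h | h
    · have ha : (SimpleGraph.join Y X y₁ y₂ p q).Adj (.inl y₁) (.inr p) := by simp
      exact ha.reachable.trans (h.map (joinInr Y X y₁ y₂ p q))
    · have ha : (SimpleGraph.join Y X y₁ y₂ p q).Adj (.inl y₂) (.inr q) := by simp
      exact ((hl y₂).trans ha.reachable).trans (h.map (joinInr Y X y₁ y₂ p q))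

lemma dist_join_inl_inl (hY : Y.Connected) (h : ∀ u, X.Reachable p u ∨ X.Reachable q u)
    (x y : W) : (join Y X r r p q).dist (.inl x) (.inl y) = Y.dist x y := by
  refine le_antisymm (dist_join_inl_inl_le hY r r x y) ?_
  obtain ⟨w, hw⟩ := (hY.join h r r).exists_walk_length_eq_dist (.inl x) (.inl y)
  have := w.le_add_length_of_forall_adj (f := Sum.elim (Y.dist x) (fun _ => Y.dist x r)) (by
    rintro (a | a) (b | b) hab
    · have hab' : Y.Adj a b := hab
      have := hY.dist_triangle (u := x) (v := a) (w := b)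
      rw [dist_eq_one_iff_adj.2 hab'] at this
      exact this
    · have : a = r := by simp at hab; tauto
      simp [this]
    · have : b = r := by simp at hab; tauto
      simp [this]
    · simp)
  simp at this
  omega

lemma dist_join_inl_inr (hY : Y.Connected) (h : ∀ u, X.Reachable p u ∨ X.Reachable q u)
    (x : W) (u : U) :
    (join Y X r r p q).dist (.inl x) (.inr u) = Y.dist x r + X.portDist p q u := by
  have hJ := hY.join h r r
  apply le_antisymm
  · obtain ⟨w, hw⟩ := exists_walk_join_inr (Y := Y) (r := r) h u
    have h1 := dist_join_inl_inl_le (X := X) (p := p) (q := q) hY r r x r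
    have h2 := hJ.dist_triangle (u := .inl x) (v := .inl r) (w := .inr u)
    have h3 := dist_le w
    omega
  · obtain ⟨w, hw⟩ := hJ.exists_walk_length_eq_dist (.inl x) (.inr u)
    have hw' := w.le_add_length_of_forall_adj
      (f := Sum.elim (fun y => Y.dist x r - Y.dist y r)
        (fun v => Y.dist x r + X.portDist p q v)) (by
      rintro (a | a) (b | b) hab
      · have hab' : Y.Adj a b := hab
        have := hY.dist_triangle (u := a) (v := b) (w := r)
        rw [dist_eq_one_iff_adj.2 hab'] at this
        simp only [Sum.elim_inl]; omega
      · have hab' : (a = r ∧ b = p) ∨ (a = r ∧ b = q) := hab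
        rcases hab' with ⟨rfl, rfl⟩ | ⟨rfl, rfl⟩ <;> simp
      · have hab' : (b = r ∧ a = p) ∨ (b = r ∧ a = q) := hab
        rcases hab' with ⟨rfl, rfl⟩ | ⟨rfl, rfl⟩ <;> simp <;> omega
      · have := Adj.portDist_le (show X.Adj a b from hab) (h a)
        simp only [Sum.elim_inr]; omega)
    simp only [Sum.elim_inl, Sum.elim_inr] at hw'
    omega

lemma dist_join_inr_inr_le (hY : Y.Connected) (h : ∀ u, X.Reachable p u ∨ X.Reachable q u)
    (u v : U) :
    (join Y X r r p q).dist (.inr u) (.inr v) ≤ X.portDist p q u + X.portDist p q v := by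
  have hJ := hY.join h r r
  have h1 := hJ.dist_triangle (u := .inr u) (v := .inl r) (w := .inr v)
  have h2 := dist_join_inl_inr (r := r) hY h r u
  have h3 := dist_join_inl_inr (r := r) hY h r v
  rw [dist_comm, dist_self] at h2
  rw [dist_self] at h3
  omega

end joinDist

/-- A graph that can be joined, at the vertices `p` and `q`, to a single vertex of another graph
without creating cycles shorter than `g`. -/
structure IsPort (g : ℕ) {U : Type*} (X : SimpleGraph U) (p q : U) : Prop where
  ne : p ≠ q
  le_egirth : (g : ℕ∞) ≤ X.egirth
  le_length_add_two : ∀ w : X.Walk p q, g ≤ w.length + 2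
  reachable : ∀ u, X.Reachable p u ∨ X.Reachable q u

open scoped Classical in
/-- A connected graph of girth at least `g` in which all degrees are `k` except that the root `r`
has degree `k - 2`; the root has eccentricity `e` and the diameter is `D`. -/
structure IsRooted (k g : ℕ) {W : Type*} (Y : SimpleGraph W) (r : W) (e D : ℕ) : Prop where
  ncard_neighborSet : ∀ x, (Y.neighborSet x).ncard + (if x = r then 2 else 0) = k
  le_egirth : (g : ℕ∞) ≤ Y.egirth
  connected : Y.Connected
  dist_root_le : ∀ x, Y.dist x r ≤ e
  exists_dist_root_eq : ∃ x, Y.dist x r = e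
  dist_le : ∀ x y, Y.dist x y ≤ D
  exists_dist_eq : ∃ x y, Y.dist x y = D

section extension

variable {k g K e D : ℕ} {W U : Type*} {Y : SimpleGraph W} {X : SimpleGraph U}
  {r : W} {p q s : U}

open scoped Classical in
lemma exists_isRooted [Finite W]
    (hdeg : ∀ x, (Y.neighborSet x).ncard + (if x = r then 2 else 0) = k)
    (hg : (g : ℕ∞) ≤ Y.egirth) (hY : Y.Connected) : ∃ e D, IsRooted k g Y r e D := by
  have : Nonempty W := ⟨r⟩
  obtain ⟨x, hx⟩ := Finite.exists_max (fun x => Y.dist x r)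
  obtain ⟨⟨a, b⟩, hab⟩ := Finite.exists_max (fun z : W × W => Y.dist z.1 z.2)
  exact ⟨_, _, hdeg, hg, hY, hx, ⟨x, rfl⟩, fun x y => hab (x, y), a, b, rfl⟩

lemma IsRooted.le_egirth_join (hY : IsRooted k g Y r e D) (hX : IsPort g X p q) :
    (g : ℕ∞) ≤ (join Y X r r p q).egirth :=
  SimpleGraph.le_egirth_join hX.ne hY.le_egirth hX.le_egirth fun a b => by
    have := hX.le_length_add_two b
    omega

lemma IsRooted.dist_join_le (hY : IsRooted k g Y r e D) (hX : IsPort g X p q)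
    (hK : ∀ u, X.portDist p q u ≤ K) (he : 2 * K ≤ e) (a b : W ⊕ U) :
    (join Y X r r p q).dist a b ≤ max D (e + K) := by
  rcases a with a | a <;> rcases b with b | b
  · rw [dist_join_inl_inl hY.connected hX.reachable]
    exact (hY.dist_le a b).trans (le_max_left _ _)
  · rw [dist_join_inl_inr hY.connected hX.reachable]
    have := hY.dist_root_le a
    have := hK b
    omega
  · rw [dist_comm, dist_join_inl_inr hY.connected hX.reachable]
    have := hY.dist_root_le b
    have := hK a
    omega
  · have := dist_join_inr_inr_le (r := r) hY.connected hX.reachable a b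
    have := hK a
    have := hK b
    omega

lemma IsRooted.exists_dist_join_eq (hY : IsRooted k g Y r e D) (hX : IsPort g X p q)
    (hK : ∃ u, X.portDist p q u = K) :
    ∃ a b, (join Y X r r p q).dist a b = max D (e + K) := by
  rcases le_total D (e + K) with h | h
  · obtain ⟨u, hu⟩ := hK
    obtain ⟨x, hx⟩ := hY.exists_dist_root_eq
    exact ⟨.inl x, .inr u, by
      rw [dist_join_inl_inr hY.connected hX.reachable, hu, hx, max_eq_right h]⟩
  · obtain ⟨x, y, hxy⟩ := hY.exists_dist_eq
    exact ⟨.inl x, .inl y, by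
      rw [dist_join_inl_inl hY.connected hX.reachable, hxy, max_eq_left h]⟩

open scoped Classical in
lemma IsRooted.ncard_neighborSet_join [Finite W] [Finite U] (hY : IsRooted k g Y r e D)
    (hX : IsPort g X p q)
    (hdeg : ∀ u, (X.neighborSet u).ncard + (if u = p then 1 else 0) + (if u = q then 1 else 0) +
      (if u = s then 2 else 0) = k) (a : W ⊕ U) :
    ((join Y X r r p q).neighborSet a).ncard + (if a = .inr s then 2 else 0) = k := by
  rcases a with x | u
  · rw [ncard_neighborSet_join_inl hX.ne]
    have := hY.ncard_neighborSet x
    split_ifs at * <;> simp_all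
  · rw [ncard_neighborSet_join_inr hX.ne, ← hdeg u]
    simp only [Sum.inr.injEq]

open scoped Classical in
lemma IsRooted.join [Finite W] [Finite U] (hY : IsRooted k g Y r e D) (hX : IsPort g X p q)
    (hdeg : ∀ u, (X.neighborSet u).ncard + (if u = p then 1 else 0) + (if u = q then 1 else 0) +
      (if u = s then 2 else 0) = k)
    (hK : ∀ u, X.portDist p q u ≤ K) (hK' : ∃ u, X.portDist p q u = K) (he : 2 * K ≤ e) :
    IsRooted k g (join Y X r r p q) (.inr s) (e + X.portDist p q s) (max D (e + K)) where
  ncard_neighborSet a := by convert hY.ncard_neighborSet_join hX hdeg a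
  le_egirth := hY.le_egirth_join hX
  connected := hY.connected.join hX.reachable r r
  dist_root_le := by
    rintro (x | u)
    · rw [dist_join_inl_inr hY.connected hX.reachable]
      have := hY.dist_root_le x
      omega
    · have := dist_join_inr_inr_le (r := r) hY.connected hX.reachable u s
      have := hK u
      omega
  exists_dist_root_eq := by
    obtain ⟨x, hx⟩ := hY.exists_dist_root_eq
    exact ⟨.inl x, by rw [dist_join_inl_inr hY.connected hX.reachable, hx]⟩
  dist_le := hY.dist_join_le hX hK he
  exists_dist_eq := hY.exists_dist_join_eq hX hK'

open scoped Classical in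
lemma IsRooted.exists_join [Finite W] [Finite U] (hY : IsRooted k g Y r e D) (hX : IsPort g X p q)
    (hdeg : ∀ u, (X.neighborSet u).ncard + (if u = p then 1 else 0) + (if u = q then 1 else 0) +
      (if u = s then 2 else 0) = k) :
    ∃ e' D', e + 1 ≤ e' ∧ IsRooted k g (SimpleGraph.join Y X r r p q) (.inr s) e' D' := by
  obtain ⟨e', D', h⟩ := exists_isRooted (k := k) (r := Sum.inr s)
    (fun a => by convert hY.ncard_neighborSet_join hX hdeg a)
    (hY.le_egirth_join hX) (hY.connected.join hX.reachable r r)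
  refine ⟨e', D', ?_, h⟩
  obtain ⟨x, hx⟩ := hY.exists_dist_root_eq
  have := h.dist_root_le (.inl x)
  rw [dist_join_inl_inr hY.connected hX.reachable, hx, portDist] at this
  omega

end extension

/-- There is a rooted graph with the given parameters on `N` vertices. -/
def HasRooted (k g N e D : ℕ) : Prop :=
  ∃ (W : Type) (_ : Finite W) (Y : SimpleGraph W) (r : W), Nat.card W = N ∧ IsRooted k g Y r e D

section chain

variable {k g K e D N m : ℕ} {U : Type} [Finite U] {X : SimpleGraph U} {p q s : U}

open scoped Classical in
lemma HasRooted.exists_le (h : HasRooted k g N e D) (hX : IsPort g X p q)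
    (hdeg : ∀ u, (X.neighborSet u).ncard + (if u = p then 1 else 0) + (if u = q then 1 else 0) +
      (if u = s then 2 else 0) = k) (B : ℕ) :
    ∃ N e D, B ≤ e ∧ HasRooted k g N e D := by
  induction B with
  | zero => exact ⟨N, e, D, Nat.zero_le _, h⟩
  | succ B ih =>
    obtain ⟨N, e, D, hB, W, hW, Y, r, -, hY⟩ := ih
    obtain ⟨e', D', he, h'⟩ := hY.exists_join hX hdeg
    exact ⟨_, e', D', by omega, W ⊕ U, inferInstance, _, _, rfl, h'⟩

open scoped Classical in
lemma HasRooted.iterate (h : HasRooted k g N e D) (hX : IsPort g X p q)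
    (hdeg : ∀ u, (X.neighborSet u).ncard + (if u = p then 1 else 0) + (if u = q then 1 else 0) +
      (if u = s then 2 else 0) = k)
    (hK : ∀ u, X.portDist p q u ≤ K) (hK' : ∃ u, X.portDist p q u = K) (he : 2 * K ≤ e) (m : ℕ) :
    HasRooted k g (N + (m + 1) * Nat.card U) (e + (m + 1) * X.portDist p q s)
      (max D (e + m * X.portDist p q s + K)) := by
  induction m with
  | zero =>
    obtain ⟨W, hW, Y, r, hN, hY⟩ := h
    refine ⟨W ⊕ U, inferInstance, _, _, ?_, by simpa using hY.join hX hdeg hK hK' he⟩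
    rw [Nat.card_sum, hN]
    ring
  | succ m ih =>
    obtain ⟨W, hW, Y, r, hN, hY⟩ := ih
    refine ⟨W ⊕ U, inferInstance, SimpleGraph.join Y X r r p q, .inr s, ?_, ?_⟩
    · rw [Nat.card_sum, hN]
      ring
    · convert hY.join hX hdeg hK hK' (he.trans (Nat.le_add_right _ _)) using 1
      · ring
      · rw [max_assoc, max_eq_right (a := e + m * X.portDist p q s + K)]
        gcongr
        omega

end chain

section gadgets

variable {k g : ℕ} {V : Type*} {G H : SimpleGraph V} {a b c p q : V}

lemma Connected.exists_reachable_of_forall_adj (hG : G.Connected) {S : Set V} (hS : S.Nonempty)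
    (h : ∀ u v, G.Adj u v → H.Adj u v ∨ v ∈ S) (u : V) : ∃ s ∈ S, H.Reachable s u := by
  obtain ⟨r, hr⟩ := hS
  obtain ⟨w⟩ := hG.preconnected u r
  induction w with
  | nil => exact ⟨_, hr, .rfl⟩
  | @cons u v r huv w ih =>
    obtain ⟨s, hs, hsv⟩ := ih hr
    rcases h v u huv.symm with h | h
    · exact ⟨s, hs, hsv.trans h.reachable⟩
    · exact ⟨u, h, .rfl⟩

lemma Connected.reachable_deleteEdges_singleton (hG : G.Connected) (u : V) :
    (G.deleteEdges {s(p, q)}).Reachable p u ∨ (G.deleteEdges {s(p, q)}).Reachable q u := by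
  have := hG.exists_reachable_of_forall_adj (H := G.deleteEdges {s(p, q)})
    (Set.insert_nonempty p {q}) (fun x y hxy => by
      simp only [deleteEdges_adj, hxy, Set.mem_singleton_iff, true_and, Set.mem_insert_iff,
        Sym2.eq_iff]
      tauto) u
  simpa using this

/-- Deleting an edge of a connected graph opens it for joining at the ends of that edge. -/
lemma Connected.isPort_deleteEdges (hG : G.Connected) (hg : (g : ℕ∞) ≤ G.egirth)
    (hpq : G.Adj p q) : IsPort g (G.deleteEdges {s(p, q)}) p q where
  ne := hpq.ne
  le_egirth := hg.trans (egirth_anti (deleteEdges_le _))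
  le_length_add_two w := by
    have := natCast_le_egirth_iff.1 hg p q hpq w
    omega
  reachable := hG.reachable_deleteEdges_singleton

/-- `G` without the edges `ab` and `ac`. -/
abbrev deleteFork (G : SimpleGraph V) (a b c : V) : SimpleGraph V :=
  (G.deleteEdges {s(a, b)}).deleteEdges {s(a, c)}

lemma le_length_add_one_of_deleteFork_left (hg : (g : ℕ∞) ≤ G.egirth) (hab : G.Adj a b)
    (w : (G.deleteFork a b c).Walk a b) : g ≤ w.length + 1 := by
  simpa using natCast_le_egirth_iff.1 hg a b hab (w.mapLe (deleteEdges_le _))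

lemma le_length_add_one_of_deleteFork_right (hg : (g : ℕ∞) ≤ G.egirth) (hac : G.Adj a c)
    (w : (G.deleteFork a b c).Walk a c) : g ≤ w.length + 1 := by
  have hle : G.deleteFork a b c ≤ G.deleteEdges {s(a, c)} :=
    deleteEdges_mono (deleteEdges_le _)
  simpa using natCast_le_egirth_iff.1 hg a c hac (w.mapLe hle)

/-- Deleting two edges `ab` and `ac` opens a graph for joining at `b` and `c`. -/
lemma Connected.isPort_deleteFork (hG : G.Connected) (hg : (g : ℕ∞) ≤ G.egirth) (hab : G.Adj a b)
    (hac : G.Adj a c) (hbc : b ≠ c) (hr : (G.deleteFork a b c).Reachable b a) :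
    IsPort g (G.deleteFork a b c) b c where
  ne := hbc
  le_egirth := hg.trans (egirth_anti ((deleteEdges_le _).trans (deleteEdges_le _)))
  le_length_add_two w := by
    have hle : G.deleteFork a b c ≤ G.deleteEdges {s(a, c)} :=
      deleteEdges_mono (deleteEdges_le _)
    have hab' : (G.deleteEdges {s(a, c)}).Adj a b := by
      simp [hab, hbc, hab.ne']
    simpa using natCast_le_egirth_iff.1 hg a c hac (.cons hab' (w.mapLe hle))
  reachable u := by
    obtain ⟨s, hs, h⟩ := hG.exists_reachable_of_forall_adj (H := G.deleteFork a b c)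
      (S := {a, b, c}) (Set.insert_nonempty _ _) (fun x y hxy => by
        simp only [deleteEdges_adj, hxy, Set.mem_singleton_iff, true_and, Set.mem_insert_iff,
          Sym2.eq_iff]
        tauto) u
    rcases hs with rfl | rfl | rfl
    · exact .inl (hr.trans h)
    · exact .inl h
    · exact .inr h

lemma portDist_deleteFork (hg : (g : ℕ∞) ≤ G.egirth) (hab : G.Adj a b) (hac : G.Adj a c)
    (w : (G.deleteFork a b c).Walk b a) (hw : w.length + 1 = g) :
    (G.deleteFork a b c).portDist b c a = g := by
  refine le_antisymm ((portDist_le_length_add_one w).trans_eq hw) ?_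
  rcases exists_walk_length_add_one_eq_portDist (q := c) (.inl w.reachable) with ⟨v, hv⟩ | ⟨v, hv⟩
  · rw [← hv]
    simpa using le_length_add_one_of_deleteFork_left hg hab v.reverse
  · rw [← hv]
    simpa using le_length_add_one_of_deleteFork_right hg hac v.reverse

open scoped Classical in
lemma ncard_neighborSet_deleteFork [Finite V] (hdeg : ∀ v, (G.neighborSet v).ncard = k)
    (hab : G.Adj a b) (hac : G.Adj a c) (hbc : b ≠ c) (u : V) :
    ((G.deleteFork a b c).neighborSet u).ncard + (if u = b then 1 else 0) +
      (if u = c then 1 else 0) + (if u = a then 2 else 0) = k := by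
  have hac' : (G.deleteEdges {s(a, b)}).Adj a c := by simp [hac, hbc.symm, hac.ne']
  have h1 := ncard_neighborSet_deleteEdges_singleton hab u
  have h2 := ncard_neighborSet_deleteEdges_singleton hac' u
  rw [deleteFork, ← hdeg u, ← h1, ← h2]
  split_ifs <;> omega

lemma egirth_deleteEdges_le (hab : G.Adj a b) (hbc : b ≠ c)
    (w : (G.deleteFork a b c).Walk b a) (hw : w.length + 1 = g) :
    (G.deleteEdges {s(a, c)}).egirth ≤ g := by
  by_contra! hlt
  have h : ((g + 1 : ℕ) : ℕ∞) ≤ (G.deleteEdges {s(a, c)}).egirth := by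
    push_cast
    exact Order.add_one_le_of_lt hlt
  have hadj : (G.deleteEdges {s(a, c)}).Adj a b := by simp [hab, hbc, hab.ne']
  have := natCast_le_egirth_iff.1 h a b hadj (w.reverse.mapLe (by
    rw [deleteFork, deleteEdges_deleteEdges, deleteEdges_deleteEdges, Set.union_comm]))
  simp at this
  omega

/-- Two copies of `G`, one without the edge `ab` and one without the edges `ab` and `ac`, joined
so that only the copy of `a` in the second one is missing edges. -/
abbrev forkDouble (G : SimpleGraph V) (a b c : V) : SimpleGraph (V ⊕ V) :=
  join (G.deleteEdges {s(a, b)}) (G.deleteFork a b c) a b b c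

lemma le_egirth_forkDouble (hG : G.Connected) (hg : (g : ℕ∞) ≤ G.egirth) (hab : G.Adj a b)
    (hac : G.Adj a c) (hbc : b ≠ c) (hr : (G.deleteFork a b c).Reachable b a) :
    (g : ℕ∞) ≤ (G.forkDouble a b c).egirth := by
  have hP := hG.isPort_deleteFork hg hab hac hbc hr
  refine le_egirth_join hbc (hg.trans (egirth_anti (deleteEdges_le _))) hP.le_egirth
    fun x y => ?_
  have := hP.le_length_add_two y
  omega

lemma connected_forkDouble (hG : G.Connected) (hg : (g : ℕ∞) ≤ G.egirth) (hab : G.Adj a b)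
    (hac : G.Adj a c) (hbc : b ≠ c) (hr : (G.deleteFork a b c).Reachable b a) :
    (G.forkDouble a b c).Connected := by
  have hP := hG.isPort_deleteFork hg hab hac hbc hr
  refine Connected.join ?_ hP.reachable a b
  rw [connected_iff_exists_forall_reachable]
  refine ⟨a, fun u => ?_⟩
  rcases hG.reachable_deleteEdges_singleton (p := a) (q := b) u with h | h
  · exact h
  · exact (hr.mono (deleteEdges_le _)).symm.trans h

open scoped Classical in
lemma ncard_neighborSet_forkDouble [Finite V] (hdeg : ∀ v, (G.neighborSet v).ncard = k)
    (hab : G.Adj a b) (hac : G.Adj a c) (hbc : b ≠ c) (x : V ⊕ V) :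
    ((G.forkDouble a b c).neighborSet x).ncard + (if x = .inr a then 2 else 0) = k := by
  rcases x with x | u
  · rw [ncard_neighborSet_join_inl hbc, ncard_neighborSet_deleteEdges_singleton hab, hdeg]
    simp
  · rw [ncard_neighborSet_join_inr hbc, ← ncard_neighborSet_deleteFork hdeg hab hac hbc u]
    simp only [Sum.inr.injEq]

lemma le_length_of_forkDouble (hg : (g : ℕ∞) ≤ G.egirth) (hab : G.Adj a b)
    (hac : G.Adj a c) {x : V} (w : (G.forkDouble a b c).Walk (.inl x) (.inr a)) :
    g ≤ w.length := by
  have hb : g - 1 ≤ (G.deleteFork a b c).truncDist (g - 1) a b :=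
    le_truncDist le_rfl fun v => by
      have := le_length_add_one_of_deleteFork_left hg hab v
      omega
  have hc : g - 1 ≤ (G.deleteFork a b c).truncDist (g - 1) a c :=
    le_truncDist le_rfl fun v => by
      have := le_length_add_one_of_deleteFork_right hg hac v
      omega
  have := w.reverse.le_add_length_of_forall_adj
    (f := Sum.elim (fun _ => g) ((G.deleteFork a b c).truncDist (g - 1) a)) (by
    rintro (y | y) (z | z) hyz
    · simp
    · simp only [Sum.elim_inl, Sum.elim_inr]
      have : (G.deleteFork a b c).truncDist (g - 1) a z ≤ g - 1 := truncDist_le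
      omega
    · simp only [Sum.elim_inl, Sum.elim_inr]
      rcases (join_adj_inr_inl.1 hyz) with ⟨-, rfl⟩ | ⟨-, rfl⟩ <;> omega
    · exact (join_adj_inr_inr.1 hyz).truncDist_le)
  simpa using this

lemma portDist_forkDouble_deleteEdges (hg : (g : ℕ∞) ≤ G.egirth) (hab : G.Adj a b)
    (hac : G.Adj a c) (w : (G.deleteFork a b c).Walk b a) (hw : w.length + 1 = g) :
    ((G.forkDouble a b c).deleteEdges {s(.inl a, .inl c)}).portDist (.inl a) (.inl c) (.inr a) =
      g + 1 := by
  have hadj : ((G.forkDouble a b c).deleteEdges {s(.inl a, .inl c)}).Adj (.inl a) (.inr b) := by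
    simp
  let φ : G.deleteFork a b c →g (G.forkDouble a b c).deleteEdges {s(.inl a, .inl c)} :=
    ⟨Sum.inr, fun {x y} h => by simpa using h⟩
  have hφ := portDist_le_length_add_one (q := .inl c) (Walk.cons hadj (w.map φ))
  rw [Walk.length_cons, (w.length_map φ : (w.map φ).length = _), hw] at hφ
  refine le_antisymm hφ ?_
  have hr : ((G.forkDouble a b c).deleteEdges {s(.inl a, .inl c)}).Reachable (.inl a) (.inr a) :=
    (Walk.cons hadj (w.map φ)).reachable
  rcases exists_walk_length_add_one_eq_portDist (q := .inl c) (.inl hr) with ⟨v, hv⟩ | ⟨v, hv⟩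
  all_goals
    have := le_length_of_forkDouble hg hab hac (v.mapLe (deleteEdges_le _))
    rw [Walk.length_map] at this
    rw [← hv]
    omega

open scoped Classical in
lemma ncard_neighborSet_forkDouble_deleteEdges [Finite V]
    (hdeg : ∀ v, (G.neighborSet v).ncard = k)
    (hab : G.Adj a b) (hac : G.Adj a c) (hbc : b ≠ c) (x : V ⊕ V) :
    (((G.forkDouble a b c).deleteEdges {s(.inl a, .inl c)}).neighborSet x).ncard +
      (if x = .inl a then 1 else 0) + (if x = .inl c then 1 else 0) +
      (if x = .inr a then 2 else 0) = k := by
  have hadj : (G.forkDouble a b c).Adj (.inl a) (.inl c) := by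
    simp [hac, hbc.symm, hac.ne']
  have h1 := ncard_neighborSet_deleteEdges_singleton hadj x
  have h2 := ncard_neighborSet_forkDouble hdeg hab hac hbc x
  grind

end gadgets

section assembly

variable {k g : ℕ}

lemma Connected.ediam_eq {V : Type*} {G : SimpleGraph V} {d : ℕ} (hG : G.Connected)
    (h : ∀ u v, G.dist u v ≤ d) (h' : ∃ u v, G.dist u v = d) : G.ediam = d := by
  apply le_antisymm
  · refine ediam_le_of_edist_le fun u v => ?_
    rw [← (hG.preconnected u v).coe_dist_eq_edist]
    exact_mod_cast h u v
  · obtain ⟨u, v, rfl⟩ := h'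
    rw [(hG.preconnected u v).coe_dist_eq_edist]
    exact edist_le_ediam

lemma exists_portDist_max {U : Type*} [Finite U] (X : SimpleGraph U) (p q : U) :
    ∃ K, (∀ u, X.portDist p q u ≤ K) ∧ ∃ u, X.portDist p q u = K := by
  have : Nonempty U := ⟨p⟩
  obtain ⟨u, hu⟩ := Finite.exists_max (X.portDist p q)
  exact ⟨_, hu, u, rfl⟩

variable {V : Type} [Finite V] {G : SimpleGraph V} {a b c : V}

/-- Closing a rooted graph with a copy of `G` without the edge `ac`. -/
lemma HasRooted.exists_isKGDGraph {N e D K : ℕ} (h : HasRooted k g N e D)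
    (hG : G.Connected) (hdeg : ∀ v, (G.neighborSet v).ncard = k) (hg : (g : ℕ∞) ≤ G.egirth)
    (hac : G.Adj a c) (hg' : (G.deleteEdges {s(a, c)}).egirth ≤ g)
    (hK : ∀ u, (G.deleteEdges {s(a, c)}).portDist a c u ≤ K)
    (hKmax : ∃ u, (G.deleteEdges {s(a, c)}).portDist a c u = K) (he : 2 * K ≤ e) :
    ∃ (W : Type) (_ : Finite W) (Y : SimpleGraph W), Nat.card W = N + Nat.card V ∧
      IsKGDGraph k g (max D (e + K)) Y := by
  obtain ⟨W, hW, Y, r, rfl, hY⟩ := h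
  have hP := hG.isPort_deleteEdges hg hac
  refine ⟨W ⊕ V, inferInstance, SimpleGraph.join Y (G.deleteEdges {s(a, c)}) r r a c,
    Nat.card_sum, ?_, ?_, ?_⟩
  · rintro (x | u)
    · rw [ncard_neighborSet_join_inl hac.ne]
      have := hY.ncard_neighborSet x
      split_ifs at * <;> omega
    · rw [ncard_neighborSet_join_inr hac.ne, ncard_neighborSet_deleteEdges_singleton hac, hdeg]
  · refine le_antisymm (le_trans (IsContained.egirth_le ?_) hg') (hY.le_egirth_join hP)
    exact ⟨⟨joinInr Y _ r r a c, Sum.inr_injective⟩⟩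
  · exact (hY.connected.join hP.reachable r r).ediam_eq (hY.dist_join_le hP hK he)
      (hY.exists_dist_join_eq hP hKmax)

/-- Chaining copies of a connected regular graph realises every residue of the diameter
modulo `g`. -/
lemma exists_forall_exists_isKGDGraph (hG : G.Connected)
    (hdeg : ∀ v, (G.neighborSet v).ncard = k) (hg : (g : ℕ∞) ≤ G.egirth) (hab : G.Adj a b)
    (hac : G.Adj a c) (hbc : b ≠ c) (w : (G.deleteFork a b c).Walk b a)
    (hw : w.length + 1 = g) :
    ∃ κ, ∀ j, ∃ C m₀, ∀ m, m₀ ≤ m → ∃ (W : Type) (_ : Finite W) (Y : SimpleGraph W),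
      Nat.card W ≤ C + m * Nat.card V ∧ IsKGDGraph k g (κ + j + m * g) Y := by
  classical
  have hr := w.reachable
  have hP₁ := hG.isPort_deleteFork hg hab hac hbc hr
  have hs₁ := portDist_deleteFork hg hab hac w hw
  have hdeg₁ := ncard_neighborSet_deleteFork hdeg hab hac hbc
  have hadj : (G.forkDouble a b c).Adj (.inl a) (.inl c) := by simp [hac, hbc.symm, hac.ne']
  have hZ := connected_forkDouble hG hg hab hac hbc hr
  have hP₂ := hZ.isPort_deleteEdges (le_egirth_forkDouble hG hg hab hac hbc hr) hadj
  have hs₂ := portDist_forkDouble_deleteEdges hg hab hac w hw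
  obtain ⟨K₁, hK₁, hK₁'⟩ := exists_portDist_max (G.deleteFork a b c) b c
  obtain ⟨K₂, hK₂, hK₂'⟩ := exists_portDist_max
    ((G.forkDouble a b c).deleteEdges {s(.inl a, .inl c)}) (.inl a) (.inl c)
  obtain ⟨K₃, hK₃, hK₃'⟩ := exists_portDist_max (G.deleteEdges {s(a, c)}) a c
  obtain ⟨e, D, hstart⟩ := exists_isRooted (k := k) (r := Sum.inr a)
    (fun x => by convert ncard_neighborSet_forkDouble hdeg hab hac hbc x)
    (le_egirth_forkDouble hG hg hab hac hbc hr) hZ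
  obtain ⟨N, e, D, he, h⟩ := HasRooted.exists_le ⟨_, inferInstance, _, _, rfl, hstart⟩ hP₁ hdeg₁
    (2 * (K₁ + K₂ + K₃))
  refine ⟨e + max K₁ (g + K₃), fun j => ?_⟩
  obtain ⟨N', D', h'⟩ : ∃ N' D', HasRooted k g N' (e + j * (g + 1)) D' := by
    cases j with
    | zero => exact ⟨N, D, by simpa using h⟩
    | succ j =>
      have := h.iterate (s := .inr a) hP₂
        (fun x => by convert ncard_neighborSet_forkDouble_deleteEdges hdeg hab hac hbc x)
        hK₂ hK₂' (by omega) j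
      rw [hs₂] at this
      exact ⟨_, _, this⟩
  refine ⟨N' + 2 * Nat.card V, j + D', fun m hm => ?_⟩
  obtain ⟨l, rfl⟩ := Nat.exists_eq_add_of_le hm
  have h₁ := h'.iterate hP₁ hdeg₁ hK₁ hK₁' (by nlinarith) (D' + l)
  rw [hs₁] at h₁
  obtain ⟨W, hW, Y, hcard, hY⟩ := h₁.exists_isKGDGraph hG hdeg hg hac
    (egirth_deleteEdges_le hab hbc w hw) hK₃ hK₃' (by nlinarith)
  refine ⟨W, hW, Y, ?_, ?_⟩
  · rw [hcard]
    nlinarith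
  · convert hY using 1
    have h0 : D' ≤ D' * g := Nat.le_mul_of_pos_right _ (by omega)
    have h1 : e + j * (g + 1) + (D' + l + 1) * g + K₃ =
      e + j + (j + D' + l) * g + (g + K₃) := by ring
    have h2 : e + j * (g + 1) + (D' + l) * g + K₁ = e + j + (j + D' + l) * g + K₁ := by ring
    have h3 : D' ≤ e + j + (j + D' + l) * g := by nlinarith
    rw [h1, h2]
    omega

end assembly

section cage

variable {k g : ℕ} {V : Type*} {G : SimpleGraph V}

lemma ConnectedComponent.ncard_neighborSet_toSimpleGraph (C : G.ConnectedComponent) (v : C) :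
    (C.toSimpleGraph.neighborSet v).ncard = (G.neighborSet v).ncard := by
  rw [← Set.ncard_image_of_injective _ Subtype.val_injective]
  congr 1
  ext u
  constructor
  · rintro ⟨u, hu, rfl⟩
    exact hu
  · intro hu
    exact ⟨⟨u, C.mem_supp_of_adj_mem_supp v.2 hu⟩, hu, rfl⟩

/-- Some connected component has the girth of the whole graph. -/
lemma exists_egirth_toSimpleGraph_eq (h : G.egirth = g) :
    ∃ C : G.ConnectedComponent, C.toSimpleGraph.egirth = g := by
  have hc : ¬ G.IsAcyclic := by
    rw [← egirth_eq_top, h]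
    exact ENat.natCast_ne_top g
  obtain ⟨a, w, hw, hlen⟩ := exists_egirth_eq_length.2 hc
  let C := G.connectedComponentMk a
  have hs : ∀ x ∈ w.support, x ∈ C.supp := fun x hx => by
    classical
    exact (ConnectedComponent.sound (w.takeUntil x hx).reachable).symm
  refine ⟨C, le_antisymm ?_ ?_⟩
  · have hw' : (w.induce C.supp hs).IsCycle :=
      (Walk.isCycle_map_iff_of_injective (f := (Embedding.induce C.supp).toHom)
        Subtype.val_injective).1 (by rw [Walk.map_induce]; exact hw)
    have hl := congrArg List.length (w.support_induce hs)
    rw [Walk.length_support, List.length_attachWith, Walk.length_support] at hl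
    rw [← h, hlen, ← Nat.succ_injective hl]
    exact egirth_le_length hw'
  · rw [← h]
    exact IsContained.egirth_le ⟨⟨C.toSimpleGraph_hom, Subtype.val_injective⟩⟩

/-- In a regular graph, a shortest cycle through an edge `ab` avoids some other edge `ac`. -/
lemma exists_walk_deleteFork (hk : 3 ≤ k) (hdeg : ∀ v, (G.neighborSet v).ncard = k)
    (h : G.egirth = g) :
    ∃ a b c, G.Adj a b ∧ G.Adj a c ∧ b ≠ c ∧
      ∃ w : (G.deleteFork a b c).Walk b a, w.length + 1 = g := by
  have hc : ¬ G.IsAcyclic := by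
    rw [← egirth_eq_top, h]
    exact ENat.natCast_ne_top g
  obtain ⟨a, w, hw, hlen⟩ := exists_egirth_eq_length.2 hc
  rw [h] at hlen
  obtain ⟨c, hac, hc⟩ : ∃ c ∈ G.neighborSet a, c ∉ w.toSubgraph.neighborSet a := by
    refine Set.exists_mem_notMem_of_ncard_lt_ncard ?_
      (Set.finite_of_ncard_ne_zero ?_)
    all_goals rw [hw.ncard_neighborSet_toSubgraph_eq_two w.start_mem_support]
    · rw [hdeg]
      omega
    · omega
  replace hc : s(a, c) ∉ w.edges := by
    rwa [← Walk.mem_edges_toSubgraph]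
  cases w with
  | nil => simp at hw
  | @cons _ b _ hab p =>
    rw [Walk.cons_isCycle_iff] at hw
    rw [Walk.edges_cons, List.mem_cons, not_or] at hc
    refine ⟨a, b, c, hab, hac, fun hbc => hc.1 (by rw [hbc]),
      (p.toDeleteEdge s(a, b) hw.2).toDeleteEdge s(a, c) ?_, ?_⟩
    · simpa using hc.2
    · simpa using (Nat.cast_injective hlen).symm

variable {W : Type*} {H : SimpleGraph W}

lemma Hom.edist_map_le (φ : G →g H) (u v : V) : H.edist (φ u) (φ v) ≤ G.edist u v :=
  le_iInf fun w => (edist_le (w.map φ)).trans_eq (congrArg _ (w.length_map φ))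

lemma Iso.ediam_le (φ : G ≃g H) : H.ediam ≤ G.ediam :=
  ediam_le_of_edist_le fun u v => by
    have := (Hom.edist_map_le φ.toHom (φ.symm u) (φ.symm v)).trans edist_le_ediam
    simpa using this

lemma Iso.isKGDGraph {d : ℕ} (φ : G ≃g H) (h : IsKGDGraph k g d G) : IsKGDGraph k g d H := by
  refine ⟨fun v => ?_, φ.egirth_eq.symm.trans h.2.1,
    (le_antisymm φ.ediam_le φ.symm.ediam_le).trans h.2.2⟩
  have := Set.ncard_image_of_injective (G.neighborSet (φ.symm v)) φ.injective
  rw [h.1, φ.image_neighborSet] at this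
  simpa using this

lemma exists_fin_isKGDGraph {W : Type*} [Finite W] {Y : SimpleGraph W} {d : ℕ}
    (h : IsKGDGraph k g d Y) : ∃ Y' : SimpleGraph (Fin (Nat.card W)), IsKGDGraph k g d Y' :=
  ⟨_, (Iso.map (Finite.equivFin W) Y).isKGDGraph h⟩

end cage
end SimpleGraph

/-- Families covering every residue of the diameter modulo `g` cover every large diameter. -/
lemma exists_forall_of_residues {P : ℕ → ℕ → Prop} {g n κ : ℕ} (hg : 0 < g)
    (h : ∀ j, ∃ C m₀, ∀ m, m₀ ≤ m → ∃ N, N ≤ C + m * n ∧ P N (κ + j + m * g)) :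
    ∃ C : ℝ, ∃ d₀ : ℕ, ∀ d, d₀ ≤ d → ∃ N : ℕ, (N : ℝ) ≤ (n : ℝ) / g * d + C ∧ P N d := by
  choose C m₀ h using h
  refine ⟨((∑ j ∈ Finset.range g, C j : ℕ) : ℝ), κ + (∑ j ∈ Finset.range g, m₀ j) * g,
    fun d hd => ?_⟩
  obtain ⟨d, rfl⟩ := Nat.exists_eq_add_of_le ((Nat.le_add_right _ _).trans hd)
  have hj : d % g ∈ Finset.range g := Finset.mem_range.2 (Nat.mod_lt _ hg)
  have hm : m₀ (d % g) ≤ d / g := by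
    rw [Nat.le_div_iff_mul_le hg]
    have := Finset.single_le_sum (f := m₀) (fun _ _ => Nat.zero_le _) hj
    nlinarith
  obtain ⟨N, hN, hP⟩ := h (d % g) (d / g) hm
  refine ⟨N, ?_, by rwa [add_assoc, mul_comm, Nat.mod_add_div] at hP⟩
  have hC : C (d % g) ≤ ∑ j ∈ Finset.range g, C j :=
    Finset.single_le_sum (fun _ _ => Nat.zero_le _) hj
  have hd' : ((d / g : ℕ) : ℝ) ≤ d / g := Nat.cast_div_le
  have hN' : (N : ℝ) ≤ (∑ j ∈ Finset.range g, C j : ℕ) + (d / g : ℕ) * (n : ℝ) := by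
    exact_mod_cast hN.trans (Nat.add_le_add_right hC _)
  have hκ : (n : ℝ) / g * d ≤ (n : ℝ) / g * (κ + d : ℕ) := by
    gcongr
    omega
  have : ((d / g : ℕ) : ℝ) * n ≤ (n : ℝ) / g * d := by
    calc ((d / g : ℕ) : ℝ) * n ≤ d / g * n := by gcongr
      _ = (n : ℝ) / g * d := by ring
  linarith

/-- A linear bound on natural numbers has nonnegative slope. -/
lemma nonneg_of_forall_nonneg_mul_add {c C : ℝ} {d₀ : ℕ} (h : ∀ d : ℕ, d₀ ≤ d → 0 ≤ c * d + C) :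
    0 ≤ c := by
  by_contra! hc
  obtain ⟨d, hd⟩ := exists_nat_gt (C / (-c))
  have h1 := h (max d d₀) (le_max_right _ _)
  have h2 : (d : ℝ) ≤ (max d d₀ : ℕ) := by exact_mod_cast le_max_left _ _
  rw [div_lt_iff₀ (by linarith)] at hd
  nlinarith

theorem fRatio_upper_bound (k g : ℕ) (hk : 3 ≤ k) (hg : 3 ≤ g) :
    fRatio k g ≤ (cageOrder k g : ℝ) / g := by
  rcases Set.eq_empty_or_nonempty
    {n : ℕ | ∃ G : SimpleGraph (Fin n), IsRegular' k G ∧ G.egirth = g} with he | hne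
  · have : fRatio k g = 0 := by
      refine (congrArg sInf (Set.eq_empty_of_forall_notMem ?_)).trans Real.sInf_empty
      rintro c ⟨C, d₀, h⟩
      obtain ⟨n, -, G, hG⟩ := h d₀ le_rfl
      exact (he ▸ Set.notMem_empty n) ⟨G, hG.1, hG.2.1⟩
    rw [this]
    positivity
  obtain ⟨G, hdeg, hG⟩ := Nat.sInf_mem hne
  obtain ⟨Cc, hC⟩ := SimpleGraph.exists_egirth_toSimpleGraph_eq hG
  have hdegC : ∀ v, (Cc.toSimpleGraph.neighborSet v).ncard = k := fun v =>
    (Cc.ncard_neighborSet_toSimpleGraph v).trans (hdeg v)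
  obtain ⟨a, b, c, hab, hac, hbc, w, hw⟩ := SimpleGraph.exists_walk_deleteFork hk hdegC hC
  obtain ⟨κ, hκ⟩ := SimpleGraph.exists_forall_exists_isKGDGraph Cc.connected_toSimpleGraph hdegC
    hC.ge hab hac hbc w hw
  have hcard : Nat.card Cc ≤ cageOrder k g := by
    exact (Nat.card_le_card_of_injective (fun v : Cc => v.1) Subtype.val_injective).trans_eq
      (Nat.card_fin _)
  refine csInf_le ⟨0, ?_⟩ (exists_forall_of_residues (κ := κ) (by omega) fun j => ?_)
  · rintro c ⟨C, d₀, h⟩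
    refine nonneg_of_forall_nonneg_mul_add (C := C) (d₀ := d₀) fun d hd => ?_
    obtain ⟨n, hn, -⟩ := h d hd
    exact n.cast_nonneg.trans hn
  · obtain ⟨C, m₀, h⟩ := hκ j
    refine ⟨C, m₀, fun m hm => ?_⟩
    obtain ⟨W, hW, Y, hcW, hY⟩ := h m hm
    exact ⟨Nat.card W, hcW.trans (by gcongr), SimpleGraph.exists_fin_isKGDGraph hY⟩
end

section
/- f(3,7) > 22/7. Equivalently, the ratio between the order and the diameter of 3-regular graphs of girth 7 is asymptotically strictly larger than M(3,7)/7 = 22/7. -/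
/-- No closed non-backtracking walk of length at most `6`. -/
structure NoShortCycle {V : Type*} (G : SimpleGraph V) : Prop where
  three : ∀ a b c, G.Adj a b → G.Adj b c → G.Adj c a → False
  four : ∀ a b c d, G.Adj a b → G.Adj b c → G.Adj c d → G.Adj d a → a ≠ c → b ≠ d → False
  five : ∀ a b c d e, G.Adj a b → G.Adj b c → G.Adj c d → G.Adj d e → G.Adj e a → False
  six : ∀ a b c d e f, G.Adj a b → G.Adj b c → G.Adj c d → G.Adj d e → G.Adj e f → G.Adj f a →
    a ≠ c → b ≠ d → c ≠ e → d ≠ f → e ≠ a → f ≠ b → False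

namespace SimpleGraph

variable {V : Type*} {G : SimpleGraph V}

theorem noShortCycle_of_le_egirth (h : (7 : ℕ∞) ≤ G.egirth) : NoShortCycle G := by
  have key : ∀ (a : V) (w : G.Walk a a), w.IsCycle → 7 ≤ w.length := fun a w hw => by
    exact_mod_cast le_egirth.1 h a w hw
  have h3 : ∀ a b c, G.Adj a b → G.Adj b c → G.Adj c a → False := by
    intro a b c hab hbc hca
    have hw : (Walk.cons hab (.cons hbc (.cons hca .nil))).IsCycle := by
      simp [Walk.cons_isCycle_iff, hab.ne', hca.ne', hab.ne, hbc.ne, hca.ne]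
    simpa using key _ _ hw
  have h5 : ∀ a b c d e, G.Adj a b → G.Adj b c → G.Adj c d → G.Adj d e → G.Adj e a → False := by
    intro a b c d e hab hbc hcd hde hea
    have hac : a ≠ c := by rintro rfl; exact h3 _ _ _ hcd hde hea
    have hbd : b ≠ d := by rintro rfl; exact h3 _ _ _ hde hea hab
    have hce : c ≠ e := by rintro rfl; exact h3 _ _ _ hea hab hbc
    have hda : d ≠ a := by rintro rfl; exact h3 _ _ _ hab hbc hcd
    have heb : e ≠ b := by rintro rfl; exact h3 _ _ _ hbc hcd hde
    have hw : (Walk.cons hab (.cons hbc (.cons hcd (.cons hde (.cons hea .nil))))).IsCycle := by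
      simp [Walk.cons_isCycle_iff, hab.ne', hea.ne', hab.ne, hbc.ne,
        hcd.ne, hde.ne, hea.ne, hac, hbd, hce, hda, hac.symm, hda.symm, heb.symm]
    simpa using key _ _ hw
  refine ⟨h3, ?_, h5, ?_⟩
  · intro a b c d hab hbc hcd hda hac hbd
    have hw : (Walk.cons hab (.cons hbc (.cons hcd (.cons hda .nil)))).IsCycle := by
      simp [Walk.cons_isCycle_iff, hab.ne', hda.ne', hab.ne, hbc.ne,
        hcd.ne, hda.ne, hac, hbd, hac.symm]
    simpa using key _ _ hw
  · intro a b c d e f hab hbc hcd hde hef hfa hac hbd hce hdf hea hfb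
    have had : a ≠ d := by rintro rfl; exact h3 _ _ _ hab hbc hcd
    have hbe : b ≠ e := by rintro rfl; exact h3 _ _ _ hbc hcd hde
    have hcf : c ≠ f := by rintro rfl; exact h3 _ _ _ hcd hde hef
    have hw : (Walk.cons hab (.cons hbc (.cons hcd (.cons hde (.cons hef
        (.cons hfa .nil)))))).IsCycle := by
      simp [Walk.cons_isCycle_iff, hab.ne', hfa.ne', hab.ne,
        hbc.ne, hcd.ne, hde.ne, hef.ne, hfa.ne, hac, hbd, hce, hdf, hea, hac.symm,
        hea.symm, hfb.symm, had, hbe, hcf, had.symm]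
    simpa using key _ _ hw

theorem _root_.NoShortCycle.le_egirth (h : NoShortCycle G) : (7 : ℕ∞) ≤ G.egirth := by
  rw [SimpleGraph.le_egirth]
  intro a w hw
  by_contra! hlt
  have hlt : w.length < 7 := by exact_mod_cast hlt
  have h3 := hw.three_le_length
  have hnd := hw.support_nodup
  match w with
  | .cons (v := b) h1 (.cons (v := c) h2 (.cons h3 .nil)) => exact h.three _ _ _ h1 h2 h3
  | .cons (v := b) h1 (.cons (v := c) h2 (.cons (v := d) h3 (.cons h4 .nil))) =>
    simp at hnd
    exact h.four _ _ _ _ h1 h2 h3 h4 (by grind) (by grind)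
  | .cons (v := b) h1 (.cons (v := c) h2 (.cons (v := d) h3 (.cons h4 (.cons h5 .nil)))) =>
    exact h.five _ _ _ _ _ h1 h2 h3 h4 h5
  | .cons (v := b) h1 (.cons (v := c) h2 (.cons (v := d) h3 (.cons (v := e) h4
      (.cons (v := f) h5 (.cons h6 .nil))))) =>
    simp at hnd
    exact h.six _ _ _ _ _ _ h1 h2 h3 h4 h5 h6 (by grind) (by grind) (by grind) (by grind)
      (by grind) (by grind)
  | .nil => simp at h3
  | .cons h1 .nil => simp at h3
  | .cons h1 (.cons h2 .nil) => simp at h3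
  | .cons h1 (.cons h2 (.cons h3 (.cons h4 (.cons h5 (.cons h6 (.cons h7 q)))))) =>
    simp at hlt; omega

end SimpleGraph

/-- `w` is reached from `x` by a walk of length at most `3`. -/
def WithinThree {V : Type*} (G : SimpleGraph V) (x w : V) : Prop :=
  w = x ∨ G.Adj x w ∨ (∃ y, G.Adj x y ∧ G.Adj y w) ∨ ∃ y z, G.Adj x y ∧ G.Adj y z ∧ G.Adj z w

section Ball

variable {V : Type*} [Fintype V] [DecidableEq V] {G : SimpleGraph V} [DecidableRel G.Adj]

theorem exists_ball_three (hreg : ∀ v, (G.neighborFinset v).card = 3) (hG : NoShortCycle G)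
    (x : V) : ∃ T : Finset V, T.card = 22 ∧ ∀ w ∈ T, WithinThree G x w := by
  have he : ∀ {v y : V}, G.Adj v y → ((G.neighborFinset y).erase v).card = 2 := by
    intro v y h
    rw [Finset.card_erase_of_mem (by simpa using h.symm), hreg]
  set S1 := G.neighborFinset x with hS1
  set S2 := S1.biUnion fun y => (G.neighborFinset y).erase x with hS2
  set S3 := S1.biUnion fun y => ((G.neighborFinset y).erase x).biUnion fun z =>
    (G.neighborFinset z).erase y with hS3
  have m1 : ∀ w, w ∈ S1 ↔ G.Adj x w := by simp [hS1]
  have m2 : ∀ w, w ∈ S2 ↔ ∃ y, G.Adj x y ∧ w ≠ x ∧ G.Adj y w := by simp [hS2, hS1]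
  have m3 : ∀ w, w ∈ S3 ↔ ∃ y, G.Adj x y ∧ ∃ z, (z ≠ x ∧ G.Adj y z) ∧ w ≠ y ∧ G.Adj z w := by
    simp [hS3, hS1]
  have c2 : S2.card = 6 := by
    rw [hS2, Finset.card_biUnion]
    · rw [Finset.sum_congr rfl (g := fun _ => 2) fun y hy => he ((m1 y).1 hy)]
      simp [hS1, hreg]
    · intro y hy y' hy' hne
      rw [Function.onFun, Finset.disjoint_left]
      intro w hw hw'
      simp only [Finset.mem_erase, SimpleGraph.mem_neighborFinset] at hw hw'
      exact hG.four x y w y' ((m1 y).1 hy) hw.2 hw'.2.symm ((m1 y').1 hy').symm hw.1.symm hne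
  have c3 : S3.card = 12 := by
    rw [hS3, Finset.card_biUnion]
    · rw [Finset.sum_congr rfl (g := fun _ => 4)]
      · simp [hS1, hreg]
      intro y hy
      have hy := (m1 y).1 hy
      rw [Finset.card_biUnion]
      · rw [Finset.sum_congr rfl (g := fun _ => 2)]
        · simp [he hy]
        · intro z hz
          simp only [Finset.mem_erase, SimpleGraph.mem_neighborFinset] at hz
          exact he hz.2
      · intro z hz z' hz' hne
        rw [Function.onFun, Finset.disjoint_left]
        intro w hw hw'
        simp only [Finset.mem_coe, Finset.mem_erase, SimpleGraph.mem_neighborFinset]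
          at hw hw' hz hz'
        exact hG.four y z w z' hz.2 hw.2 hw'.2.symm hz'.2.symm hw.1.symm hne
    · intro y hy y' hy' hne
      rw [Function.onFun, Finset.disjoint_left]
      intro w hw hw'
      have hy := (m1 y).1 hy
      have hy' := (m1 y').1 hy'
      simp only [Finset.mem_biUnion, Finset.mem_erase, SimpleGraph.mem_neighborFinset] at hw hw'
      obtain ⟨z, ⟨hzx, hyz⟩, hwy, hzw⟩ := hw
      obtain ⟨z', ⟨hzx', hyz'⟩, hwy', hzw'⟩ := hw'
      by_cases hzz : z = z'
      · subst hzz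
        exact hG.four x y z y' hy hyz hyz'.symm hy'.symm hzx.symm hne
      · exact hG.six x y z w z' y' hy hyz hzw hzw'.symm hyz'.symm hy'.symm hzx.symm hwy.symm hzz
          hwy' hzx' hne.symm
  have d12 : Disjoint S1 S2 := by
    rw [Finset.disjoint_left]
    intro w h1 h2
    obtain ⟨y, hy, -, hyw⟩ := (m2 w).1 h2
    exact hG.three x y w hy hyw ((m1 w).1 h1).symm
  have d13 : Disjoint S1 S3 := by
    rw [Finset.disjoint_left]
    intro w h1 h2
    obtain ⟨y, hy, z, ⟨hzx, hyz⟩, hwy, hzw⟩ := (m3 w).1 h2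
    exact hG.four x y z w hy hyz hzw ((m1 w).1 h1).symm hzx.symm hwy.symm
  have d23 : Disjoint S2 S3 := by
    rw [Finset.disjoint_left]
    intro w h1 h2
    obtain ⟨y, hy, z, ⟨hzx, hyz⟩, hwy, hzw⟩ := (m3 w).1 h2
    obtain ⟨y', hy', -, hyw'⟩ := (m2 w).1 h1
    exact hG.five x y z w y' hy hyz hzw hyw'.symm hy'.symm
  have x1 : x ∉ S1 := by simp [m1]
  have x2 : x ∉ S2 := by simp [m2]
  have x3 : x ∉ S3 := by
    rw [m3]
    rintro ⟨y, hy, z, ⟨hzx, hyz⟩, hwy, hzw⟩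
    exact hG.three x y z hy hyz hzw
  refine ⟨insert x (S1 ∪ (S2 ∪ S3)), ?_, ?_⟩
  · rw [Finset.card_insert_of_notMem (by simp [x1, x2, x3]), Finset.card_union_of_disjoint
      (by simp [d12, d13]), Finset.card_union_of_disjoint d23, c2, c3, hS1, hreg]
  · intro w hw
    simp only [Finset.mem_insert, Finset.mem_union, m1, m2, m3] at hw
    rcases hw with h | h | ⟨y, h1, -, h2⟩ | ⟨y, h1, z, ⟨-, h2⟩, -, h3⟩
    · exact .inl h
    · exact .inr (.inl h)
    · exact .inr (.inr (.inl ⟨y, h1, h2⟩))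
    · exact .inr (.inr (.inr ⟨y, z, h1, h2, h3⟩))

end Ball

/-- A function on the vertices behaving like the distance from a root, with maximum at least `d`. -/
structure Layering {V : Type*} (G : SimpleGraph V) (ℓ : V → ℕ) (d : ℕ) : Prop where
  le_succ : ∀ {x y}, G.Adj x y → ℓ x ≤ ℓ y + 1
  exists_down : ∀ x, 0 < ℓ x → ∃ y, G.Adj x y ∧ ℓ y + 1 = ℓ x
  exists_top : ∃ x, ℓ x = d

namespace Layering

variable {V : Type*} {G : SimpleGraph V} {ℓ : V → ℕ} {d : ℕ}

theorem exists_eq (hL : Layering G ℓ d) {j : ℕ} (hj : j ≤ d) : ∃ x, ℓ x = j := by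
  induction hj using Nat.decreasingInduction with
  | self => exact hL.exists_top
  | of_succ k hk ih =>
    obtain ⟨x, hx⟩ := ih
    obtain ⟨y, -, hy⟩ := hL.exists_down x (by omega)
    exact ⟨y, by omega⟩

theorem exists_chain (hL : Layering G ℓ d) {x z : V} (h : WithinThree G x z)
    (hz : ℓ z = ℓ x + 3) :
    ∃ y t, G.Adj x y ∧ G.Adj y t ∧ G.Adj t z ∧ ℓ y = ℓ x + 1 ∧ ℓ t = ℓ x + 2 := by
  rcases h with rfl | h | ⟨y, h1, h2⟩ | ⟨y, t, h1, h2, h3⟩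
  · omega
  · have := hL.le_succ h.symm; omega
  · have := hL.le_succ h1.symm; have := hL.le_succ h2.symm; omega
  · have := hL.le_succ h1.symm
    have := hL.le_succ h2.symm
    have := hL.le_succ h3.symm
    exact ⟨y, t, h1, h2, h3, by omega, by omega⟩

/-- Two upper neighbours of one vertex force two lower neighbours of any vertex four layers
higher. -/
theorem exists_two_down (hL : Layering G ℓ d) (hG : NoShortCycle G) {x y y' z : V}
    (hy : G.Adj x y) (hy' : G.Adj x y') (hne : y ≠ y') (hly : ℓ y = ℓ x + 1)
    (hly' : ℓ y' = ℓ x + 1) (hz : ℓ z = ℓ x + 4) (h : WithinThree G y z)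
    (h' : WithinThree G y' z) :
    ∃ t t', G.Adj z t ∧ G.Adj z t' ∧ t ≠ t' ∧ ℓ t = ℓ x + 3 ∧ ℓ t' = ℓ x + 3 := by
  obtain ⟨s, t, hys, hst, htz, hls, hlt⟩ := hL.exists_chain h (by omega)
  obtain ⟨s', t', hys', hst', htz', hls', hlt'⟩ := hL.exists_chain h' (by omega)
  refine ⟨t, t', htz.symm, htz'.symm, ?_, by omega, by omega⟩
  rintro rfl
  by_cases hss : s = s'
  · subst hss
    exact hG.four x y s y' hy hys hys'.symm hy'.symm (by rintro rfl; omega) hne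
  · exact hG.six x y s t s' y' hy hys hst hst'.symm hys'.symm hy'.symm (by rintro rfl; omega)
      (by rintro rfl; omega) hss (by rintro rfl; omega) (by rintro rfl; omega) hne.symm

/-- Two lower neighbours of one vertex force two upper neighbours of any vertex four layers
lower. -/
theorem exists_two_up (hL : Layering G ℓ d) (hG : NoShortCycle G) {x t t' z : V}
    (ht : G.Adj z t) (ht' : G.Adj z t') (hne : t ≠ t') (hlt : ℓ t = ℓ x + 3)
    (hlt' : ℓ t' = ℓ x + 3) (hz : ℓ z = ℓ x + 4) (h : WithinThree G x t)
    (h' : WithinThree G x t') :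
    ∃ y y', G.Adj x y ∧ G.Adj x y' ∧ y ≠ y' ∧ ℓ y = ℓ x + 1 ∧ ℓ y' = ℓ x + 1 := by
  obtain ⟨y, s, hxy, hys, hst, hly, hls⟩ := hL.exists_chain h (by omega)
  obtain ⟨y', s', hxy', hys', hst', hly', hls'⟩ := hL.exists_chain h' (by omega)
  refine ⟨y, y', hxy, hxy', ?_, by omega, by omega⟩
  rintro rfl
  by_cases hss : s = s'
  · subst hss
    exact hG.four z t s t' ht hst.symm hst' ht'.symm (by rintro rfl; omega) hne
  · exact hG.six z t s y s' t' ht hst.symm hys.symm hys' hst' ht'.symm (by rintro rfl; omega)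
      (by rintro rfl; omega) hss (by rintro rfl; omega) (by rintro rfl; omega) hne.symm

variable [Fintype V] [DecidableEq V] [DecidableRel G.Adj]

variable (ℓ) in
/-- The vertices of a layer. -/
def layer (j : ℕ) : Finset V := {x | ℓ x = j}

variable (G ℓ) in
/-- The neighbours of a vertex in the next layer. -/
def up (x : V) : Finset V := {y ∈ G.neighborFinset x | ℓ y = ℓ x + 1}

variable (G ℓ) in
/-- The neighbours of a vertex in the previous layer. -/
def down (x : V) : Finset V := {y ∈ G.neighborFinset x | ℓ y + 1 = ℓ x}

omit [DecidableEq V] [DecidableRel G.Adj] in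
theorem mem_layer {j : ℕ} {x : V} : x ∈ layer ℓ j ↔ ℓ x = j := by simp [layer]

omit [DecidableEq V] in
theorem mem_up {x y : V} : y ∈ up G ℓ x ↔ G.Adj x y ∧ ℓ y = ℓ x + 1 := by simp [up]

omit [DecidableEq V] in
theorem mem_down {x y : V} : y ∈ down G ℓ x ↔ G.Adj x y ∧ ℓ y + 1 = ℓ x := by simp [down]

theorem card_up_add_card_down_le (hreg : ∀ v, (G.neighborFinset v).card = 3) (x : V) :
    (up G ℓ x).card + (down G ℓ x).card ≤ 3 := by
  rw [← hreg x, ← Finset.card_union_of_disjoint]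
  · apply Finset.card_le_card
    intro y hy
    rw [Finset.mem_union, mem_up, mem_down] at hy
    rw [SimpleGraph.mem_neighborFinset]
    tauto
  · rw [Finset.disjoint_left]
    intro y hy hy'
    rw [mem_up] at hy
    rw [mem_down] at hy'
    omega

theorem horizontal_unique (hreg : ∀ v, (G.neighborFinset v).card = 3) {q b b' : V}
    (hU : (up G ℓ q).card = 1) (hD : (down G ℓ q).card = 1) (hb : G.Adj q b) (hb' : G.Adj q b')
    (hl : ℓ b = ℓ q) (hl' : ℓ b' = ℓ q) : b = b' := by
  by_contra hne
  obtain ⟨u, hu⟩ := Finset.card_pos.1 (hU ▸ Nat.one_pos)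
  obtain ⟨v, hv⟩ := Finset.card_pos.1 (hD ▸ Nat.one_pos)
  rw [mem_up] at hu
  rw [mem_down] at hv
  have h4 : ({u, v, b, b'} : Finset V).card = 4 := by
    rw [Finset.card_insert_of_notMem, Finset.card_insert_of_notMem, Finset.card_pair hne]
    · simp only [Finset.mem_insert, Finset.mem_singleton]
      rintro (rfl | rfl) <;> omega
    · simp only [Finset.mem_insert, Finset.mem_singleton]
      rintro (rfl | rfl | rfl) <;> omega
  have hsub : ({u, v, b, b'} : Finset V) ⊆ G.neighborFinset q := by
    intro y hy
    simp only [Finset.mem_insert, Finset.mem_singleton] at hy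
    rw [SimpleGraph.mem_neighborFinset]
    rcases hy with rfl | rfl | rfl | rfl
    exacts [hu.1, hv.1, hb, hb']
  have := Finset.card_le_card hsub
  rw [hreg] at this
  omega

omit [DecidableRel G.Adj] [DecidableEq V] in
theorem not_three_in_layer {j : ℕ} (h : (layer ℓ j).card ≤ 2) {a b c : V} (ha : ℓ a = j)
    (hb : ℓ b = j) (hc : ℓ c = j) (hab : a ≠ b) (hac : a ≠ c) (hbc : b ≠ c) : False := by
  have := Finset.two_lt_card.2 ⟨a, mem_layer.2 ha, b, mem_layer.2 hb, c, mem_layer.2 hc, hab,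
    hac, hbc⟩
  omega

/-- The layer sizes `2, 4, 8, 4, 2` with a perfect matching inside the middle layer cannot occur
if vertices of the middle layer are pairwise at distance at most `3`. -/
theorem false_of_middle (hL : Layering G ℓ d) (hreg : ∀ v, (G.neighborFinset v).card = 3)
    (hG : NoShortCycle G) {m : ℕ} (hm : 2 ≤ m) (hp : ∃ p, ℓ p = m)
    (hnear : ∀ p w, ℓ p = m → ℓ w = m → WithinThree G p w)
    (hU : ∀ q, ℓ q = m → (up G ℓ q).card = 1) (hD : ∀ q, ℓ q = m → (down G ℓ q).card = 1)
    (hs : ∀ s, ℓ s + 1 = m → (up G ℓ s).card = 2) (hy : ∀ y, ℓ y = m + 1 → (down G ℓ y).card = 2)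
    (hup : ∀ y, ℓ y = m + 1 → ∃ t, G.Adj y t ∧ ℓ t = m + 2)
    (hlo : (layer ℓ (m - 2)).card ≤ 2) (hhi : (layer ℓ (m + 2)).card ≤ 2) : False := by
  have hup' : ∀ q, ℓ q = m → ∃ t, G.Adj q t ∧ ℓ t = m + 1 := by
    intro q hq
    obtain ⟨t, ht⟩ := Finset.card_pos.1 (hU q hq ▸ Nat.one_pos)
    rw [mem_up, hq] at ht
    exact ⟨t, ht⟩
  have hU' : ∀ q a b, ℓ q = m → G.Adj q a → G.Adj q b → ℓ a = m + 1 → ℓ b = m + 1 → a = b := by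
    intro q a b hq ha hb hla hlb
    exact Finset.card_le_one.1 (hU q hq).le a (mem_up.2 ⟨ha, by omega⟩) b
      (mem_up.2 ⟨hb, by omega⟩)
  have hD' : ∀ q a b, ℓ q = m → G.Adj q a → G.Adj q b → ℓ a + 1 = m → ℓ b + 1 = m → a = b := by
    intro q a b hq ha hb hla hlb
    exact Finset.card_le_one.1 (hD q hq).le a (mem_down.2 ⟨ha, by omega⟩) b
      (mem_down.2 ⟨hb, by omega⟩)
  obtain ⟨p, hp⟩ := hp
  obtain ⟨y, hpy, hly⟩ := hup' p hp
  obtain ⟨p', hp', hpp⟩ := Finset.exists_mem_ne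
    (by rw [hy y hly]; norm_num : 1 < (down G ℓ y).card) p
  rw [mem_down] at hp'
  obtain ⟨hyp', hlp'⟩ := hp'
  obtain ⟨s, hps, hls⟩ := hL.exists_down p' (by omega)
  obtain ⟨w, hw, hwp⟩ := Finset.exists_mem_ne
    (by rw [hs s (by omega)]; norm_num : 1 < (up G ℓ s).card) p'
  rw [mem_up] at hw
  obtain ⟨hsw, hlw⟩ := hw
  have hys : y ≠ s := by rintro rfl; omega
  have hpw : ¬ G.Adj p w := fun h => hG.five p y p' s w hpy hyp' hps hsw h.symm
  have hsp : ¬ G.Adj s p := fun h => hG.four p y p' s hpy hyp' hps h hpp.symm hys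
  have hyw : ¬ G.Adj y w := fun h => hG.four y p' s w hyp' hps hsw h.symm hys hwp.symm
  have hpw' : p ≠ w := by rintro rfl; exact hsp hsw
  rcases hnear p w hp (by omega) with h | h | ⟨b, hpb, hbw⟩ | ⟨b, c, hpb, hbc, hcw⟩
  · exact hpw' h.symm
  · exact hpw h
  · exact hG.six p y p' s w b hpy hyp' hps hsw hbw.symm hpb.symm hpp.symm hys hwp.symm
      (by rintro rfl; exact hsp hpb.symm) hpw'.symm (by rintro rfl; exact hyw hbw)
  · have hby : b ≠ y := by
      rintro rfl
      exact hG.five b c w s p' hbc hcw hsw.symm hps.symm hyp'.symm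
    have hcs : c ≠ s := by
      rintro rfl
      exact hG.five p b c p' y hpb hbc hps.symm hyp'.symm hpy.symm
    have hbw : b ≠ w := by rintro rfl; exact hpw hpb
    have hcp : p ≠ c := by rintro rfl; exact hpw hcw
    have hlb : ℓ b ≤ m := by
      by_contra! hlt
      have := hL.le_succ hpb.symm
      exact hby (hU' p b y hp hpb hpy (by omega) hly)
    have hlc : m ≤ ℓ c := by
      by_contra! hlt
      have := hL.le_succ hcw.symm
      exact hcs (hD' w c s (by omega) hcw.symm hsw.symm (by omega) (by omega))
    have hbc' := hL.le_succ hbc.symm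
    have hpb' := hL.le_succ hpb
    have hcw' := hL.le_succ hcw
    rcases (by omega : (ℓ b = m ∧ ℓ c = m) ∨ (ℓ b = m ∧ ℓ c = m + 1) ∨ (ℓ b + 1 = m ∧ ℓ c = m))
      with ⟨hb, hc⟩ | ⟨hb, hc⟩ | ⟨hb, hc⟩
    · exact hcp (horizontal_unique hreg (hU b hb) (hD b hb) hpb.symm hbc (by omega) (by omega))
    · obtain ⟨t, hst, hlt⟩ := hL.exists_down s (by omega)
      obtain ⟨q₁, hpq₁, hlq₁⟩ := hL.exists_down p (by omega)
      obtain ⟨t₁, hqt₁, hlt₁⟩ := hL.exists_down q₁ (by omega)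
      obtain ⟨q₂, hbq₂, hlq₂⟩ := hL.exists_down b (by omega)
      obtain ⟨t₂, hqt₂, hlt₂⟩ := hL.exists_down q₂ (by omega)
      refine not_three_in_layer hlo (a := t) (b := t₁) (c := t₂) (by omega) (by omega) (by omega)
        ?_ ?_ ?_
      · rintro rfl
        exact hG.six p y p' s t q₁ hpy hyp' hps hst hqt₁.symm hpq₁.symm hpp.symm hys
          (by rintro rfl; omega) (by rintro rfl; exact hsp hpq₁.symm) (by rintro rfl; omega)
          (by rintro rfl; omega)
      · rintro rfl
        refine hG.six b c w s t q₂ hbc hcw hsw.symm hst hqt₂.symm hbq₂.symm hbw hcs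
          (by rintro rfl; omega) ?_ (by rintro rfl; omega) (by rintro rfl; omega)
        rintro rfl
        exact hG.four b c w s hbc hcw hsw.symm hbq₂.symm hbw hcs
      · rintro rfl
        exact hG.five p b q₂ t₁ q₁ hpb hbq₂ hqt₂ hqt₁.symm hpq₁.symm
    · obtain ⟨t, hyt, hlt⟩ := hup y hly
      obtain ⟨y₂, hwy₂, hly₂⟩ := hup' w (by omega)
      obtain ⟨t₂, hyt₂, hlt₂⟩ := hup y₂ hly₂
      obtain ⟨y₃, hcy₃, hly₃⟩ := hup' c (by omega)
      obtain ⟨t₃, hyt₃, hlt₃⟩ := hup y₃ hly₃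
      refine not_three_in_layer hhi (a := t) (b := t₂) (c := t₃) hlt hlt₂ hlt₃ ?_ ?_ ?_
      · rintro rfl
        exact hG.six t y p' s w y₂ hyt.symm hyp' hps hsw hwy₂ hyt₂ (by rintro rfl; omega) hys
          hwp.symm (by rintro rfl; omega) (by rintro rfl; omega)
          (by rintro rfl; exact hyw hwy₂.symm)
      · rintro rfl
        refine hG.six t y p b c y₃ hyt.symm hpy.symm hpb hbc hcy₃ hyt₃ (by rintro rfl; omega)
          hby.symm hcp (by rintro rfl; omega) (by rintro rfl; omega) ?_
        rintro rfl
        exact hG.four y₃ p b c hpy.symm hpb hbc hcy₃ hby.symm hcp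
      · rintro rfl
        exact hG.five w y₂ t₂ y₃ c hwy₂ hyt₂ hyt₃.symm hcy₃.symm hcw

end Layering

/-- The sum of seven consecutive layer sizes in terms of the branching pattern below them. -/
def windowSum (b₀ b₁ b₂ b₃ b₄ b₅ b₆ b₇ b₈ : Bool) : ℕ :=
  (1 + b₀.toNat) * (1 + b₁.toNat) * (1 + b₂.toNat) +
  (1 + b₁.toNat) * (1 + b₂.toNat) * (1 + b₃.toNat) +
  (1 + b₂.toNat) * (1 + b₃.toNat) * (1 + b₄.toNat) +
  (1 + b₃.toNat) * (1 + b₄.toNat) * (1 + b₅.toNat) +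
  (1 + b₄.toNat) * (1 + b₅.toNat) * (1 + b₆.toNat) +
  (1 + b₅.toNat) * (1 + b₆.toNat) * (1 + b₇.toNat) +
  (1 + b₆.toNat) * (1 + b₇.toNat) * (1 + b₈.toNat)

set_option maxRecDepth 100000 in
set_option synthInstance.maxSize 10000 in
set_option synthInstance.maxHeartbeats 2000000 in
set_option maxHeartbeats 2000000 in
theorem not_windowSum_of_no_triple : ∀ a₀ a₁ a₂ : Bool, ¬ (a₀ && a₁ && a₂) →
    ∀ a₃, ¬ (a₁ && a₂ && a₃) → ∀ a₄, ¬ (a₂ && a₃ && a₄) → ¬ (a₀ && a₄) →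
    ∀ a₅, ¬ (a₃ && a₄ && a₅) → ¬ (a₁ && a₅) → ∀ a₆, ¬ (a₄ && a₅ && a₆) → ¬ (a₂ && a₆) →
    ∀ a₇, ¬ (a₅ && a₆ && a₇) → ¬ (a₃ && a₇) → ∀ a₈, ¬ (a₆ && a₇ && a₈) → ¬ (a₄ && a₈) →
    windowSum a₀ a₁ a₂ a₃ a₄ a₅ a₆ a₇ a₈ = 22 → ∀ a₉, ¬ (a₇ && a₈ && a₉) → ¬ (a₅ && a₉) →
    windowSum a₁ a₂ a₃ a₄ a₅ a₆ a₇ a₈ a₉ = 22 → ∀ b₀, ¬ (a₈ && a₉ && b₀) → ¬ (a₆ && b₀) →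
    windowSum a₂ a₃ a₄ a₅ a₆ a₇ a₈ a₉ b₀ = 22 → ∀ b₁, ¬ (a₉ && b₀ && b₁) → ¬ (a₇ && b₁) →
    windowSum a₃ a₄ a₅ a₆ a₇ a₈ a₉ b₀ b₁ = 22 → ∀ b₂, ¬ (b₀ && b₁ && b₂) → ¬ (a₈ && b₂) →
    windowSum a₄ a₅ a₆ a₇ a₈ a₉ b₀ b₁ b₂ = 22 → False := by
  decide

theorem eq_false_of_windowSum_of_triple : ∀ b₀ b₁ b₂ b₆ b₇ b₈ : Bool, ¬ b₀ → ¬ b₁ → ¬ b₇ → ¬ b₈ →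
    windowSum b₀ b₁ b₂ true true true b₆ b₇ b₈ = 22 → b₂ = false ∧ b₆ = false := by
  decide

theorem exists_isolated_triple {a : ℕ → Bool} {N : ℕ} (hN : 25 ≤ N)
    (hex : ∀ i, i ≤ N → ¬ (a i && a (i + 4)))
    (hw : ∀ i, i ≤ N → windowSum (a i) (a (i + 1)) (a (i + 2)) (a (i + 3)) (a (i + 4)) (a (i + 5))
      (a (i + 6)) (a (i + 7)) (a (i + 8)) = 22) :
    ∃ i, i ≤ 20 ∧ a i = false ∧ a (i + 1) = false ∧ a (i + 2) = false ∧ a (i + 3) = true ∧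
      a (i + 4) = true ∧ a (i + 5) = true ∧ a (i + 6) = false ∧ a (i + 7) = false := by
  have h3 : ∃ i, i ≤ 20 ∧ a (i + 3) = true ∧ a (i + 4) = true ∧ a (i + 5) = true := by
    by_contra! hno
    have hno' : ∀ i, i ≤ 20 → ¬ (a (i + 3) && a (i + 4) && a (i + 5)) := by
      intro i hi h
      simp only [Bool.and_eq_true] at h
      exact hno i hi h.1.1 h.1.2 h.2
    exact not_windowSum_of_no_triple _ _ _ (hno' 0 (by omega)) _ (hno' 1 (by omega))
      _ (hno' 2 (by omega)) (hex 3 (by omega)) _ (hno' 3 (by omega)) (hex 4 (by omega))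
      _ (hno' 4 (by omega)) (hex 5 (by omega)) _ (hno' 5 (by omega)) (hex 6 (by omega))
      _ (hno' 6 (by omega)) (hex 7 (by omega)) (hw 3 (by omega))
      _ (hno' 7 (by omega)) (hex 8 (by omega)) (hw 4 (by omega))
      _ (hno' 8 (by omega)) (hex 9 (by omega)) (hw 5 (by omega))
      _ (hno' 9 (by omega)) (hex 10 (by omega)) (hw 6 (by omega))
      _ (hno' 10 (by omega)) (hex 11 (by omega)) (hw 7 (by omega))
  obtain ⟨i, hi, h3, h4, h5⟩ := h3
  have hw := hw i (by omega)
  have e0 := hex i (by omega)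
  have e1 := hex (i + 1) (by omega)
  have e3 := hex (i + 3) (by omega)
  have e4 := hex (i + 4) (by omega)
  simp only [h3, h4, h5, add_assoc, Nat.reduceAdd, Bool.and_true, Bool.true_and] at hw e0 e1 e3 e4
  have := eq_false_of_windowSum_of_triple _ _ _ _ _ _ e0 e1 e3 e4 hw
  exact ⟨i, hi, by simpa using e0, by simpa using e1, this.1, h3, h4, h5, this.2, by simpa using e3⟩

namespace Layering

variable {V : Type*} {G : SimpleGraph V} {ℓ : V → ℕ} {d : ℕ}
  [Fintype V] [DecidableEq V] [DecidableRel G.Adj]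

theorem card_layer_add_three (hL : Layering G ℓ d) (hG : NoShortCycle G) {j k₀ k₁ k₂ : ℕ}
    (hx : ∃ x, ℓ x = j) (h₀ : ∀ x, ℓ x = j → (up G ℓ x).card = k₀)
    (h₁ : ∀ x, ℓ x = j + 1 → (up G ℓ x).card = k₁) (h₂ : ∀ x, ℓ x = j + 2 → (up G ℓ x).card = k₂)
    (hnear : ∀ x z, ℓ x = j → ℓ z = j + 3 → WithinThree G x z) :
    (layer ℓ (j + 3)).card = k₀ * k₁ * k₂ := by
  obtain ⟨x, rfl⟩ := hx
  have heq : layer ℓ (ℓ x + 3) =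
      (up G ℓ x).biUnion fun y => (up G ℓ y).biUnion fun t => up G ℓ t := by
    ext z
    simp only [mem_layer, Finset.mem_biUnion, mem_up]
    constructor
    · intro hz
      obtain ⟨y, t, h1, h2, h3, h4, h5⟩ := hL.exists_chain (hnear x z rfl hz) hz
      exact ⟨y, ⟨h1, h4⟩, t, ⟨h2, by omega⟩, h3, by omega⟩
    · rintro ⟨y, ⟨-, h1⟩, t, ⟨-, h2⟩, -, h3⟩
      omega
  rw [heq, Finset.card_biUnion, Finset.sum_congr rfl (g := fun _ => k₁ * k₂)]
  · simp [h₀, mul_assoc]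
  · intro y hy
    rw [mem_up] at hy
    rw [Finset.card_biUnion, Finset.sum_congr rfl (g := fun _ => k₂)]
    · simp [h₁ y hy.2]
    · intro t ht
      rw [mem_up] at ht
      exact h₂ t (by omega)
    · intro t ht t' ht' hne
      rw [Function.onFun, Finset.disjoint_left]
      intro z hz hz'
      rw [Finset.mem_coe, mem_up] at ht ht'
      rw [mem_up] at hz hz'
      exact hG.four y t z t' ht.1 hz.1 hz'.1.symm ht'.1.symm (by rintro rfl; omega) hne
  · intro y hy y' hy' hne
    rw [Function.onFun, Finset.disjoint_left]
    intro z hz hz'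
    rw [Finset.mem_coe, mem_up] at hy hy'
    simp only [Finset.mem_biUnion, mem_up] at hz hz'
    obtain ⟨t, ht, hz⟩ := hz
    obtain ⟨t', ht', hz'⟩ := hz'
    by_cases htt : t = t'
    · subst htt
      exact hG.four x y t y' hy.1 ht.1 ht'.1.symm hy'.1.symm (by rintro rfl; omega) hne
    · exact hG.six x y t z t' y' hy.1 ht.1 hz.1 hz'.1.symm ht'.1.symm hy'.1.symm
        (by rintro rfl; omega) (by rintro rfl; omega) htt (by rintro rfl; omega)
        (by rintro rfl; omega) hne.symm

/-- Forty consecutive windows of seven layers cannot all have the minimum size `22`. -/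
theorem false_of_run (hL : Layering G ℓ d) (hreg : ∀ v, (G.neighborFinset v).card = 3)
    (hG : NoShortCycle G) {J : ℕ} (hJ : 3 ≤ J) (hd : J + 43 ≤ d)
    (hnear : ∀ x w, J ≤ ℓ x → ℓ x ≤ J + 40 → ℓ w ≤ ℓ x + 3 → ℓ x ≤ ℓ w + 3 → WithinThree G x w)
    (hw : ∀ j, J ≤ j → j ≤ J + 36 → (layer ℓ j).card + (layer ℓ (j + 1)).card +
      (layer ℓ (j + 2)).card + (layer ℓ (j + 3)).card + (layer ℓ (j + 4)).card +
      (layer ℓ (j + 5)).card + (layer ℓ (j + 6)).card = 22) : False := by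
  classical
  have hUpos : ∀ x, J ≤ ℓ x → ℓ x ≤ J + 40 → 1 ≤ (up G ℓ x).card := by
    intro x h1 h2
    obtain ⟨z, hz⟩ := hL.exists_eq (j := ℓ x + 3) (by omega)
    obtain ⟨y, t, hxy, -, -, hly, -⟩ := hL.exists_chain (hnear x z h1 h2 (by omega) (by omega)) hz
    exact Finset.card_pos.2 ⟨y, mem_up.2 ⟨hxy, hly⟩⟩
  have hDpos : ∀ x, J ≤ ℓ x → 1 ≤ (down G ℓ x).card := by
    intro x h1
    obtain ⟨y, hxy, hly⟩ := hL.exists_down x (by omega)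
    exact Finset.card_pos.2 ⟨y, mem_down.2 ⟨hxy, hly⟩⟩
  have hUD : ∀ x z, J ≤ ℓ x → ℓ x ≤ J + 36 → ℓ z = ℓ x + 4 → 2 ≤ (up G ℓ x).card →
      2 ≤ (down G ℓ z).card := by
    intro x z h1 h2 hz h
    obtain ⟨y, hy, y', hy', hne⟩ := Finset.one_lt_card.1 h
    rw [mem_up] at hy hy'
    obtain ⟨t, t', ht, ht', hne, hlt, hlt'⟩ := hL.exists_two_down hG hy.1 hy'.1 hne hy.2 hy'.2 hz
      (hnear y z (by omega) (by omega) (by omega) (by omega))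
      (hnear y' z (by omega) (by omega) (by omega) (by omega))
    exact Finset.one_lt_card.2 ⟨t, mem_down.2 ⟨ht, by omega⟩, t', mem_down.2 ⟨ht', by omega⟩, hne⟩
  have hDU : ∀ x z, J ≤ ℓ x → ℓ x ≤ J + 36 → ℓ z = ℓ x + 4 → 2 ≤ (down G ℓ z).card →
      2 ≤ (up G ℓ x).card := by
    intro x z h1 h2 hz h
    obtain ⟨t, ht, t', ht', hne⟩ := Finset.one_lt_card.1 h
    rw [mem_down] at ht ht'
    obtain ⟨y, y', hy, hy', hne, hly, hly'⟩ := hL.exists_two_up hG ht.1 ht'.1 hne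
      (by omega : ℓ t = ℓ x + 3) (by omega) hz
      (hnear x t (by omega) (by omega) (by omega) (by omega))
      (hnear x t' (by omega) (by omega) (by omega) (by omega))
    exact Finset.one_lt_card.2 ⟨y, mem_up.2 ⟨hy, by omega⟩, y', mem_up.2 ⟨hy', by omega⟩, hne⟩
  set a : ℕ → Bool := fun i => decide (∃ x, ℓ x = J + i ∧ 2 ≤ (up G ℓ x).card) with ha
  have hU : ∀ i, i ≤ 36 → ∀ x, ℓ x = J + i → (up G ℓ x).card = 1 + (a i).toNat := by
    intro i hi x hx
    have h1 := hUpos x (by omega) (by omega)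
    have h2 := hDpos x (by omega)
    have h3 := card_up_add_card_down_le (ℓ := ℓ) hreg x
    by_cases h : ∃ x, ℓ x = J + i ∧ 2 ≤ (up G ℓ x).card
    · have hai : a i = true := by simpa [ha] using h
      obtain ⟨x', hx', hc⟩ := h
      obtain ⟨z, hz⟩ := hL.exists_eq (j := ℓ x + 4) (by omega)
      have := hDU x z (by omega) (by omega) hz (hUD x' z (by omega) (by omega) (by omega) hc)
      rw [hai, Bool.toNat_true]
      omega
    · have hai : a i = false := by simpa [ha] using h
      have : ¬ 2 ≤ (up G ℓ x).card := fun hc => h ⟨x, hx, hc⟩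
      rw [hai, Bool.toNat_false]
      omega
  have hD : ∀ i, i ≤ 36 → ∀ z, ℓ z = J + i + 4 → (down G ℓ z).card = 1 + (a i).toNat := by
    intro i hi z hz
    obtain ⟨x, hx⟩ := hL.exists_eq (j := J + i) (by omega)
    have h0 := hU i hi x hx
    have h1 := hUpos z (by omega) (by omega)
    have h2 := hDpos z (by omega)
    have h3 := card_up_add_card_down_le (ℓ := ℓ) hreg z
    have h4 := hUD x z (by omega) (by omega) (by omega)
    have h5 := hDU x z (by omega) (by omega) (by omega)
    have h6 := Bool.toNat_le (a i)
    by_cases h : 2 ≤ (up G ℓ x).card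
    · have := h4 h
      omega
    · have : ¬ 2 ≤ (down G ℓ z).card := fun hc => h (h5 hc)
      omega
  have hex : ∀ i, i ≤ 25 → ¬ (a i && a (i + 4)) := by
    intro i hi h
    rw [Bool.and_eq_true] at h
    obtain ⟨x, hx⟩ := hL.exists_eq (j := J + i + 4) (by omega)
    have h1 := hU (i + 4) (by omega) x (by omega)
    have h2 := hD i (by omega) x hx
    have h3 := card_up_add_card_down_le (ℓ := ℓ) hreg x
    rw [h.2, Bool.toNat_true] at h1
    rw [h.1, Bool.toNat_true] at h2
    omega
  have hl : ∀ i, i ≤ 34 → (layer ℓ (J + i + 3)).card =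
      (1 + (a i).toNat) * (1 + (a (i + 1)).toNat) * (1 + (a (i + 2)).toNat) := by
    intro i hi
    exact hL.card_layer_add_three hG (hL.exists_eq (by omega)) (hU i (by omega))
      (hU (i + 1) (by omega)) (hU (i + 2) (by omega))
      fun x z hx hz => hnear x z (by omega) (by omega) (by omega) (by omega)
  obtain ⟨i, hi, a0, a1, a2, a3, a4, a5, a6, a7⟩ := exists_isolated_triple le_rfl hex (by
    intro i hi
    rw [← hw (J + i + 3) (by omega) (by omega), windowSum, ← hl i (by omega),
      ← hl (i + 1) (by omega), ← hl (i + 2) (by omega), ← hl (i + 3) (by omega),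
      ← hl (i + 4) (by omega), ← hl (i + 5) (by omega), ← hl (i + 6) (by omega)]
    grind)
  refine hL.false_of_middle hreg hG (m := J + i + 6) (by omega) (hL.exists_eq (by omega))
    (fun p w hp hw => hnear p w (by omega) (by omega) (by omega) (by omega)) ?_ ?_ ?_ ?_ ?_ ?_ ?_
  · intro q hq
    rw [hU (i + 6) (by omega) q (by omega), a6, Bool.toNat_false]
  · intro q hq
    rw [hD (i + 2) (by omega) q (by omega), a2, Bool.toNat_false]
  · intro q hq
    rw [hU (i + 5) (by omega) q (by omega), a5, Bool.toNat_true]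
  · intro q hq
    rw [hD (i + 3) (by omega) q (by omega), a3, Bool.toNat_true]
  · intro q hq
    obtain ⟨t, ht⟩ := Finset.card_pos.1 (hUpos q (by omega) (by omega))
    rw [mem_up] at ht
    exact ⟨t, ht.1, by omega⟩
  · have := hl (i + 1) (by omega)
    simp only [add_assoc, Nat.reduceAdd, a1, a2, a3, Bool.toNat_true, Bool.toNat_false] at this
    rw [(by omega : J + i + 6 - 2 = J + (i + 4)), this]
  · have := hl (i + 5) (by omega)
    simp only [add_assoc, Nat.reduceAdd, a5, a6, a7, Bool.toNat_true, Bool.toNat_false] at this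
    rw [(by omega : J + i + 6 + 2 = J + (i + 8)), this]

/-- The vertices in seven consecutive layers. -/
def window (ℓ : V → ℕ) (j : ℕ) : Finset V := {x | j ≤ ℓ x ∧ ℓ x ≤ j + 6}

omit [DecidableEq V] in
theorem mem_window {j : ℕ} {x : V} : x ∈ window ℓ j ↔ j ≤ ℓ x ∧ ℓ x ≤ j + 6 := by simp [window]

omit [DecidableEq V] in
theorem card_window (j : ℕ) : (window ℓ j).card = (layer ℓ j).card + (layer ℓ (j + 1)).card +
      (layer ℓ (j + 2)).card + (layer ℓ (j + 3)).card + (layer ℓ (j + 4)).card +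
      (layer ℓ (j + 5)).card + (layer ℓ (j + 6)).card := by
  rw [Finset.card_eq_sum_card_fiberwise (f := ℓ) (t := Finset.Ico j (j + 7))]
  · rw [Finset.sum_Ico_eq_sum_range, Nat.add_sub_cancel_left]
    have : ∀ i ∈ Finset.range 7, {x ∈ window ℓ j | ℓ x = j + i} = layer ℓ (j + i) := by
      intro i hi
      rw [Finset.mem_range] at hi
      ext x
      rw [Finset.mem_filter, mem_window, mem_layer]
      omega
    rw [Finset.sum_congr rfl fun i hi => congrArg Finset.card (this i hi)]
    simp [Finset.sum_range_succ]
  · intro x hx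
    rw [Finset.mem_coe, mem_window] at hx
    rw [Finset.mem_coe, Finset.mem_Ico]
    omega

omit [Fintype V] [DecidableEq V] [DecidableRel G.Adj] in
theorem withinThree_window (hL : Layering G ℓ d) {x w : V} (h : WithinThree G x w) :
    ℓ w ≤ ℓ x + 3 ∧ ℓ x ≤ ℓ w + 3 := by
  rcases h with rfl | h | ⟨y, h1, h2⟩ | ⟨y, z, h1, h2, h3⟩
  · omega
  · have := hL.le_succ h; have := hL.le_succ h.symm; omega
  · have := hL.le_succ h1; have := hL.le_succ h1.symm
    have := hL.le_succ h2; have := hL.le_succ h2.symm; omega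
  · have := hL.le_succ h1; have := hL.le_succ h1.symm
    have := hL.le_succ h2; have := hL.le_succ h2.symm
    have := hL.le_succ h3; have := hL.le_succ h3.symm; omega

theorem le_card_window (hL : Layering G ℓ d) (hreg : ∀ v, (G.neighborFinset v).card = 3)
    (hG : NoShortCycle G) {j : ℕ} (hj : j + 3 ≤ d) : 22 ≤ (window ℓ j).card := by
  obtain ⟨x, hx⟩ := hL.exists_eq hj
  obtain ⟨T, hT, hw⟩ := exists_ball_three hreg hG x
  rw [← hT]
  refine Finset.card_le_card fun w h => ?_
  have := hL.withinThree_window (hw w h)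
  rw [mem_window]
  omega

theorem withinThree_of_card_window (hL : Layering G ℓ d)
    (hreg : ∀ v, (G.neighborFinset v).card = 3) (hG : NoShortCycle G) {j : ℕ}
    (hj : (window ℓ j).card = 22) {x w : V} (hx : ℓ x = j + 3) (h1 : ℓ w ≤ ℓ x + 3)
    (h2 : ℓ x ≤ ℓ w + 3) : WithinThree G x w := by
  obtain ⟨T, hT, hw⟩ := exists_ball_three hreg hG x
  have hsub : T ⊆ window ℓ j := by
    intro v h
    have := hL.withinThree_window (hw v h)
    rw [mem_window]
    omega
  apply hw
  rw [Finset.eq_of_subset_of_card_le hsub (by omega), mem_window]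
  omega

theorem exists_large_window (hL : Layering G ℓ d) (hreg : ∀ v, (G.neighborFinset v).card = 3)
    (hG : NoShortCycle G) {J : ℕ} (hd : J + 46 ≤ d) :
    ∃ j, J ≤ j ∧ j < J + 41 ∧ 23 ≤ (window ℓ j).card := by
  by_contra! h
  have h22 : ∀ j, J ≤ j → j < J + 41 → (window ℓ j).card = 22 := by
    intro j h1 h2
    have := h j h1 h2
    have := hL.le_card_window hreg hG (j := j) (by omega)
    omega
  refine hL.false_of_run hreg hG (J := J + 3) (by omega) (by omega) ?_ ?_
  · intro x w h1 h2 h3 h4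
    exact hL.withinThree_of_card_window hreg hG (h22 (ℓ x - 3) (by omega) (by omega)) (by omega)
      h3 h4
  · intro j h1 h2
    rw [← card_window, h22 j (by omega) (by omega)]

theorem le_sum_card_window (hL : Layering G ℓ d) (hreg : ∀ v, (G.neighborFinset v).card = 3)
    (hG : NoShortCycle G) (q : ℕ) (hd : 41 * q + 5 ≤ d) :
    903 * q ≤ ∑ j ∈ Finset.range (41 * q), (window ℓ j).card := by
  induction q with
  | zero => simp
  | succ q ih =>
    have ih := ih (by omega)
    obtain ⟨j, h1, h2, h3⟩ := hL.exists_large_window hreg hG (J := 41 * q) (by omega)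
    have hsum : 903 ≤ ∑ i ∈ Finset.Ico (41 * q) (41 * (q + 1)), (window ℓ i).card := by
      have hmem : j ∈ Finset.Ico (41 * q) (41 * (q + 1)) := by rw [Finset.mem_Ico]; omega
      rw [← Finset.add_sum_erase _ _ hmem]
      have := Finset.card_nsmul_le_sum ((Finset.Ico (41 * q) (41 * (q + 1))).erase j)
        (fun i => (window ℓ i).card) 22 (by
          intro i hi
          rw [Finset.mem_erase, Finset.mem_Ico] at hi
          exact hL.le_card_window hreg hG (by omega))
      rw [Finset.card_erase_of_mem hmem, Nat.card_Ico, smul_eq_mul,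
        (by omega : 41 * (q + 1) - 41 * q - 1 = 40)] at this
      omega
    rw [← Finset.sum_range_add_sum_Ico _ (by omega : 41 * q ≤ 41 * (q + 1))]
    omega

omit [DecidableEq V] in
theorem sum_card_window_le (n : ℕ) :
    ∑ j ∈ Finset.range n, (window ℓ j).card ≤ 7 * Fintype.card V := by
  have h := Finset.sum_card_bipartiteAbove_eq_sum_card_bipartiteBelow
    (s := Finset.range n) (t := (Finset.univ : Finset V)) (fun j x => j ≤ ℓ x ∧ ℓ x ≤ j + 6)
  have h' : ∑ j ∈ Finset.range n, (window ℓ j).card = _ := h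
  rw [h', mul_comm, ← Finset.card_univ, ← smul_eq_mul]
  refine Finset.sum_le_card_nsmul _ _ _ fun x _ => ?_
  have : Finset.bipartiteBelow (fun j x => j ≤ ℓ x ∧ ℓ x ≤ j + 6) (Finset.range n) x ⊆
      Finset.Icc (ℓ x - 6) (ℓ x) := by
    intro j hj
    rw [Finset.mem_bipartiteBelow] at hj
    rw [Finset.mem_Icc]
    omega
  refine (Finset.card_le_card this).trans ?_
  rw [Nat.card_Icc]
  omega

end Layering

theorem SimpleGraph.Connected.layering_dist {V : Type*} {G : SimpleGraph V} (h : G.Connected)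
    (u v : V) : Layering G (G.dist u) (G.dist u v) where
  le_succ {x y} hxy := by
    have := h.dist_triangle (u := u) (v := y) (w := x)
    rw [SimpleGraph.dist_eq_one_iff_adj.2 hxy.symm] at this
    exact this
  exists_down x hx := by
    obtain ⟨p, hp⟩ := h.exists_walk_length_eq_dist x u
    rw [SimpleGraph.dist_comm] at hp
    match p with
    | .nil => simp at hx
    | .cons (v := y) hxy q =>
      refine ⟨y, hxy, ?_⟩
      have h1 := SimpleGraph.dist_le q
      have h2 := h.dist_triangle (u := u) (v := y) (w := x)
      rw [SimpleGraph.dist_eq_one_iff_adj.2 hxy.symm] at h2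
      rw [SimpleGraph.Walk.length_cons] at hp
      rw [SimpleGraph.dist_comm] at h1
      omega
  exists_top := ⟨v, rfl⟩

theorem IsKGDGraph.le_card {d : ℕ} {V : Type*} [Fintype V] {G : SimpleGraph V} (hd : 0 < d)
    (h : IsKGDGraph 3 7 d G) : 129 * d ≤ 41 * Fintype.card V + 6000 := by
  classical
  obtain ⟨hreg, hgirth, hdiam⟩ := h
  have hne : Nonempty V := by
    by_contra hV
    rw [not_nonempty_iff] at hV
    rw [SimpleGraph.ediam_eq_zero_of_subsingleton] at hdiam
    have : (0 : ℕ) = d := by exact_mod_cast hdiam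
    omega
  have hconn : G.Connected := SimpleGraph.connected_of_ediam_ne_top (by simp [hdiam])
  obtain ⟨u, v, huv⟩ := G.exists_edist_eq_ediam_of_finite
  have hdist : G.dist u v = d := by
    rw [SimpleGraph.dist, huv, hdiam, ENat.toNat_natCast]
  have hL := hconn.layering_dist u v
  rw [hdist] at hL
  have hreg' : ∀ v, (G.neighborFinset v).card = 3 := by
    intro v
    rw [← hreg v, Set.ncard_eq_toFinset_card']
    rfl
  have hG := SimpleGraph.noShortCycle_of_le_egirth (G := G) (by rw [hgirth]; rfl)
  by_cases h5 : d < 46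
  · omega
  have h1 := hL.le_sum_card_window hreg' hG ((d - 5) / 41) (by omega)
  have h2 := Layering.sum_card_window_le (ℓ := G.dist u) (41 * ((d - 5) / 41))
  omega

theorem le_of_eventually_exists_isKGDGraph {c C : ℝ} {d₀ : ℕ} (h : ∀ d : ℕ, d₀ ≤ d →
    ∃ n : ℕ, (n : ℝ) ≤ c * d + C ∧ ∃ G : SimpleGraph (Fin n), IsKGDGraph 3 7 d G) :
    129 / 41 ≤ c := by
  by_contra! hc
  obtain ⟨m, hm⟩ := exists_nat_gt ((C + 6000 / 41) / (129 / 41 - c))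
  obtain ⟨n, hn, G, hG⟩ := h (m + d₀ + 1) (by omega)
  have h1 := hG.le_card (by omega)
  rw [Fintype.card_fin] at h1
  have h1 : (129 : ℝ) * (m + d₀ + 1 : ℕ) ≤ 41 * n + 6000 := by exact_mod_cast h1
  rw [div_lt_iff₀ (by linarith)] at hm
  push_cast at h1 hn
  have : 0 ≤ (129 / 41 - c) * ((d₀ : ℝ) + 1) := mul_nonneg (by linarith) (by positivity)
  linarith

namespace SimpleGraph

theorem Hom.edist_map_le_s7 {V W : Type*} {G : SimpleGraph V} {H : SimpleGraph W} (f : G →g H)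
    (x y : V) : H.edist (f x) (f y) ≤ G.edist x y :=
  le_iInf fun w => (edist_le (w.map f)).trans_eq (by rw [Walk.length_map])

theorem Iso.ediam_eq {V W : Type*} {G : SimpleGraph V} {H : SimpleGraph W} (f : G ≃g H) :
    H.ediam = G.ediam := by
  apply le_antisymm
  · refine ediam_le_of_edist_le fun u v => ?_
    have := (f.toHom.edist_map_le_s7 (f.symm u) (f.symm v)).trans edist_le_ediam
    simpa using this
  · refine ediam_le_of_edist_le fun u v => ?_
    have := (f.symm.toHom.edist_map_le_s7 (f u) (f v)).trans edist_le_ediam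
    simpa using this

theorem natCast_le_edist {V : Type*} {G : SimpleGraph V} {φ : V → ℕ}
    (hφ : ∀ x y, G.Adj x y → φ x ≤ φ y + 1) {x y : V} {n : ℕ} (h : φ x + n ≤ φ y) :
    (n : ℕ∞) ≤ G.edist x y := by
  have key : ∀ {x y : V} (w : G.Walk x y), φ y ≤ φ x + w.length := by
    intro x y w
    induction w with
    | nil => simp
    | cons h q ih =>
      have := hφ _ _ h.symm
      rw [Walk.length_cons]
      omega
  refine le_iInf fun w => ?_
  have := key w
  exact_mod_cast (by omega : n ≤ w.length)

/-- Two disjoint graphs joined by one additional edge. -/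
def bridge {V W : Type*} (G : SimpleGraph V) (r : V) (H : SimpleGraph W) (s : W) :
    SimpleGraph (V ⊕ W) where
  Adj
    | .inl x, .inl y => G.Adj x y
    | .inr x, .inr y => H.Adj x y
    | .inl x, .inr y => x = r ∧ y = s
    | .inr y, .inl x => x = r ∧ y = s
  symm := ⟨by
    rintro (x | x) (y | y) h
    exacts [G.adj_symm h, h, h, H.adj_symm h]⟩
  loopless := ⟨by
    rintro (x | x) h
    exacts [G.irrefl h, H.irrefl h]⟩

section Bridge

variable {V W : Type*} {G : SimpleGraph V} {r : V} {H : SimpleGraph W} {s : W}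

@[simp] theorem bridge_adj_inl {x y : V} : (bridge G r H s).Adj (.inl x) (.inl y) ↔ G.Adj x y :=
  Iff.rfl

@[simp] theorem bridge_adj_inr {x y : W} : (bridge G r H s).Adj (.inr x) (.inr y) ↔ H.Adj x y :=
  Iff.rfl

@[simp] theorem bridge_adj_inl_inr {x : V} {y : W} :
    (bridge G r H s).Adj (.inl x) (.inr y) ↔ x = r ∧ y = s := Iff.rfl

@[simp] theorem bridge_adj_inr_inl {x : V} {y : W} :
    (bridge G r H s).Adj (.inr y) (.inl x) ↔ x = r ∧ y = s := Iff.rfl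

theorem edist_bridge_inl_le (x y : V) : (bridge G r H s).edist (.inl x) (.inl y) ≤ G.edist x y :=
  Hom.edist_map_le_s7 ⟨Sum.inl, id⟩ x y

theorem edist_bridge_inr_le (x y : W) : (bridge G r H s).edist (.inr x) (.inr y) ≤ H.edist x y :=
  Hom.edist_map_le_s7 ⟨Sum.inr, id⟩ x y

theorem edist_bridge_inl_inr_le (x : V) (y : W) :
    (bridge G r H s).edist (.inl x) (.inr y) ≤ G.edist x r + 1 + H.edist s y := by
  have h : (bridge G r H s).edist (.inl r) (.inr s) = 1 := edist_eq_one_iff_adj.2 ⟨rfl, rfl⟩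
  calc _ ≤ _ := SimpleGraph.edist_triangle (v := .inr s)
    _ ≤ _ := add_le_add (SimpleGraph.edist_triangle (v := .inl r)) le_rfl
    _ ≤ _ := by
      rw [h]
      gcongr
      · exact edist_bridge_inl_le _ _
      · exact edist_bridge_inr_le _ _

theorem egirth_bridge_le : (bridge G r H s).egirth ≤ G.egirth :=
  IsContained.egirth_le ⟨⟨⟨Sum.inl, id⟩, Sum.inl_injective⟩⟩

theorem neighborSet_bridge_inl_of_ne {x : V} (hx : x ≠ r) :
    (bridge G r H s).neighborSet (.inl x) = Sum.inl '' G.neighborSet x := by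
  ext (y | y) <;> simp [hx]

theorem neighborSet_bridge_inr_of_ne {x : W} (hx : x ≠ s) :
    (bridge G r H s).neighborSet (.inr x) = Sum.inr '' H.neighborSet x := by
  ext (y | y) <;> simp [hx]

theorem neighborSet_bridge_inl : (bridge G r H s).neighborSet (.inl r) =
    insert (.inr s) (Sum.inl '' G.neighborSet r) := by
  ext (y | y) <;> simp

theorem neighborSet_bridge_inr : (bridge G r H s).neighborSet (.inr s) =
    insert (.inl r) (Sum.inr '' H.neighborSet s) := by
  ext (y | y) <;> simp

theorem ncard_bridge_inl_of_ne {x : V} (hx : x ≠ r) :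
    ((bridge G r H s).neighborSet (.inl x)).ncard = (G.neighborSet x).ncard := by
  rw [neighborSet_bridge_inl_of_ne hx, Set.ncard_image_of_injective _ Sum.inl_injective]

theorem ncard_bridge_inr_of_ne {x : W} (hx : x ≠ s) :
    ((bridge G r H s).neighborSet (.inr x)).ncard = (H.neighborSet x).ncard := by
  rw [neighborSet_bridge_inr_of_ne hx, Set.ncard_image_of_injective _ Sum.inr_injective]

theorem ncard_bridge_inl [Finite V] :
    ((bridge G r H s).neighborSet (.inl r)).ncard = (G.neighborSet r).ncard + 1 := by
  rw [neighborSet_bridge_inl, Set.ncard_insert_of_notMem (by simp),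
    Set.ncard_image_of_injective _ Sum.inl_injective]

theorem ncard_bridge_inr [Finite W] :
    ((bridge G r H s).neighborSet (.inr s)).ncard = (H.neighborSet s).ncard + 1 := by
  rw [neighborSet_bridge_inr, Set.ncard_insert_of_notMem (by simp),
    Set.ncard_image_of_injective _ Sum.inr_injective]

theorem _root_.NoShortCycle.bridge (hG : NoShortCycle G) (hH : NoShortCycle H) :
    NoShortCycle (bridge G r H s) where
  three := by
    have := G.loopless.irrefl r
    have := H.loopless.irrefl s
    have := hG.three
    have := hH.three
    rintro (a | a) (b | b) (c | c) <;>
      simp only [bridge_adj_inl, bridge_adj_inr, bridge_adj_inl_inr, bridge_adj_inr_inl] <;> grind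
  four := by
    have := G.loopless.irrefl r
    have := H.loopless.irrefl s
    have := hG.four
    have := hH.four
    rintro (a | a) (b | b) (c | c) (d | d) <;>
      simp only [bridge_adj_inl, bridge_adj_inr, bridge_adj_inl_inr, bridge_adj_inr_inl,
        ne_eq, Sum.inl.injEq, Sum.inr.injEq] <;> grind
  five := by
    have := G.loopless.irrefl r
    have := H.loopless.irrefl s
    have := hG.five
    have := hH.five
    have := hG.three
    have := hH.three
    rintro (a | a) (b | b) (c | c) (d | d) (e | e) <;>
      simp only [bridge_adj_inl, bridge_adj_inr, bridge_adj_inl_inr, bridge_adj_inr_inl] <;> grind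
  six := by
    have := G.loopless.irrefl r
    have := H.loopless.irrefl s
    have := hG.six
    have := hH.six
    rintro (a | a) (b | b) (c | c) (d | d) (e | e) (f | f) <;>
      simp only [bridge_adj_inl, bridge_adj_inr, bridge_adj_inl_inr, bridge_adj_inr_inl,
        ne_eq, Sum.inl.injEq, Sum.inr.injEq] <;> grind

end Bridge

end SimpleGraph

/-- Adjacency lists of the McGee graph with one edge subdivided by the vertex `24`. -/
def capList : Fin 25 → List (Fin 25) :=
  ![[12, 23, 24], [2, 8, 24], [1, 3, 19], [2, 4, 15], [3, 5, 11], [4, 6, 22], [5, 7, 18],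
    [6, 8, 14], [1, 7, 9], [8, 10, 21], [9, 11, 17], [4, 10, 12], [0, 11, 13], [12, 14, 20],
    [7, 13, 15], [3, 14, 16], [15, 17, 23], [10, 16, 18], [6, 17, 19], [2, 18, 20], [13, 19, 21],
    [9, 20, 22], [5, 21, 23], [0, 16, 22], [0, 1]]

/-- The distance to the vertex `24` in `capGraph`. -/
def capDist : Fin 25 → ℕ :=
  ![1, 1, 2, 3, 4, 4, 4, 3, 2, 3, 4, 3, 2, 3, 4, 4, 3, 4, 4, 3, 4, 4, 3, 2, 0]

/-- The McGee graph with one edge subdivided by the vertex `24`. -/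
def capGraph : SimpleGraph (Fin 25) where
  Adj x y := y ∈ capList x
  symm := ⟨by decide⟩
  loopless := ⟨by decide⟩

instance : DecidableRel capGraph.Adj := fun x y => inferInstanceAs (Decidable (y ∈ capList x))

theorem capGraph_noShortCycle : NoShortCycle capGraph where
  three := by
    have : ∀ a, ∀ b ∈ capList a, ∀ c ∈ capList b, a ∉ capList c := by decide
    exact fun a b c h1 h2 h3 => this a b h1 c h2 h3
  four := by
    have : ∀ a, ∀ b ∈ capList a, ∀ c ∈ capList b, a ≠ c → ∀ d ∈ capList c, b ≠ d →
      a ∉ capList d := by decide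
    exact fun a b c d h1 h2 h3 h4 hac hbd => this a b h1 c h2 hac d h3 hbd h4
  five := by
    have : ∀ a, ∀ b ∈ capList a, ∀ c ∈ capList b, ∀ d ∈ capList c, ∀ e ∈ capList d,
      a ∉ capList e := by decide
    exact fun a b c d e h1 h2 h3 h4 h5 => this a b h1 c h2 d h3 e h4 h5
  six := by
    have : ∀ a, ∀ b ∈ capList a, ∀ c ∈ capList b, a ≠ c → ∀ d ∈ capList c, b ≠ d →
      ∀ e ∈ capList d, c ≠ e → e ≠ a → ∀ f ∈ capList e, d ≠ f → f ≠ b → a ∉ capList f := by decide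
    exact fun a b c d e f h1 h2 h3 h4 h5 h6 hac hbd hce hdf hea hfb =>
      this a b h1 c h2 hac d h3 hbd e h4 hce hea f h5 hdf hfb h6

theorem capGraph_egirth_le : capGraph.egirth ≤ 7 := by
  have h : (SimpleGraph.Walk.cons (by decide : capGraph.Adj 2 1)
    (.cons (by decide : capGraph.Adj 1 8)
    (.cons (by decide : capGraph.Adj 8 7) (.cons (by decide : capGraph.Adj 7 6)
    (.cons (by decide : capGraph.Adj 6 18) (.cons (by decide : capGraph.Adj 18 19)
    (.cons (by decide : capGraph.Adj 19 2) .nil))))))).IsCycle := by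
    simp [SimpleGraph.Walk.cons_isCycle_iff]
  exact SimpleGraph.egirth_le_length h

theorem capGraph_ncard {x : Fin 25} (hx : x ≠ 24) : (capGraph.neighborSet x).ncard = 3 := by
  rw [Set.ncard_eq_toFinset_card']
  revert x
  decide

theorem capGraph_ncard_root : (capGraph.neighborSet 24).ncard = 2 := by
  rw [Set.ncard_eq_toFinset_card']
  decide

theorem capDist_le_succ : ∀ x y, capGraph.Adj x y → capDist x ≤ capDist y + 1 := by
  have : ∀ x, ∀ y ∈ capList x, capDist x ≤ capDist y + 1 := by decide
  exact this

theorem capDist_le : ∀ x, capDist x ≤ 4 := by decide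

theorem capGraph_edist_root_le (x : Fin 25) : capGraph.edist x 24 ≤ capDist x := by
  have hroot : ∀ x, capDist x = 0 → x = 24 := by decide
  have hdown : ∀ x, x ≠ 24 → ∃ y ∈ capList x, capDist y + 1 = capDist x := by decide
  obtain ⟨n, hn⟩ : ∃ n, capDist x = n := ⟨_, rfl⟩
  induction n generalizing x with
  | zero =>
    rw [hroot x hn]
    simp
  | succ n ih =>
    obtain ⟨y, hy, hd⟩ := hdown x (by rintro rfl; simp [capDist] at hn)
    refine SimpleGraph.edist_triangle.trans
      ((add_le_add (SimpleGraph.edist_eq_one_iff_adj.2 hy).le (ih y (by omega))).trans_eq ?_)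
    rw [← hd, add_comm]
    rfl

theorem capGraph_edist_root_le_four (x : Fin 25) : capGraph.edist x 24 ≤ 4 :=
  (capGraph_edist_root_le x).trans (by exact_mod_cast capDist_le x)

theorem capGraph_edist_le (x y : Fin 25) : capGraph.edist x y ≤ 8 := by
  refine (SimpleGraph.edist_triangle (v := 24)).trans ?_
  rw [SimpleGraph.edist_comm (u := 24)]
  exact (add_le_add (capGraph_edist_root_le_four x) (capGraph_edist_root_le_four y)).trans_eq rfl

/-- A pendant vertex attached to the root of the cap. -/
def pendantCap : SimpleGraph (Unit ⊕ Fin 25) := SimpleGraph.bridge ⊥ () capGraph 24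

theorem pendantCap_noShortCycle : NoShortCycle pendantCap :=
  NoShortCycle.bridge ⟨by simp, by simp, by simp, by simp⟩ capGraph_noShortCycle

theorem pendantCap_edist_le (x : Unit ⊕ Fin 25) : pendantCap.edist x (.inl ()) ≤ 5 := by
  rcases x with x | x
  · simp
  · rw [SimpleGraph.edist_comm]
    refine (SimpleGraph.edist_bridge_inl_inr_le _ _).trans ?_
    rw [SimpleGraph.edist_self, zero_add, SimpleGraph.edist_comm]
    exact (add_le_add le_rfl (capGraph_edist_root_le_four x)).trans_eq rfl

/-- A graph that is cubic apart from a root of degree `2`, has girth `7`, and has eccentricity `e`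
at the root. -/
structure IsRootedCubic {V : Type} (G : SimpleGraph V) (r : V) (e : ℕ) : Prop where
  four_le : 4 ≤ e
  ncard_root : (G.neighborSet r).ncard = 2
  ncard_of_ne : ∀ x ≠ r, (G.neighborSet x).ncard = 3
  noShortCycle : NoShortCycle G
  egirth_le : G.egirth ≤ 7
  edist_root_le : ∀ x, G.edist x r ≤ e
  edist_le : ∀ x y, G.edist x y ≤ (e + 5 : ℕ)
  exists_potential : ∃ φ : V → ℕ, (∀ x y, G.Adj x y → φ x ≤ φ y + 1) ∧ φ r = e ∧ ∃ x, φ x = 0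

theorem isRootedCubic_capGraph : IsRootedCubic capGraph 24 4 where
  four_le := le_rfl
  ncard_root := capGraph_ncard_root
  ncard_of_ne _ := capGraph_ncard
  noShortCycle := capGraph_noShortCycle
  egirth_le := capGraph_egirth_le
  edist_root_le := capGraph_edist_root_le_four
  edist_le x y := (capGraph_edist_le x y).trans (by norm_cast)
  exists_potential := by
    refine ⟨fun x => 4 - capDist x, fun x y h => ?_, rfl, 4, rfl⟩
    have := capDist_le_succ y x h.symm
    dsimp only
    omega

namespace IsRootedCubic

variable {V : Type} {G : SimpleGraph V} {r : V} {e : ℕ}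

theorem bridge_pendantCap [Finite V] (h : IsRootedCubic G r e) :
    IsRootedCubic (SimpleGraph.bridge G r pendantCap (.inl ())) (.inr (.inl ())) (e + 1) where
  four_le := by have := h.four_le; omega
  ncard_root := by
    rw [SimpleGraph.ncard_bridge_inr, pendantCap, SimpleGraph.ncard_bridge_inl]
    simp
  ncard_of_ne := by
    rintro (x | x | x) hx
    · by_cases hxr : x = r
      · rw [hxr, SimpleGraph.ncard_bridge_inl, h.ncard_root]
      · rw [SimpleGraph.ncard_bridge_inl_of_ne hxr, h.ncard_of_ne x hxr]
    · exact absurd rfl hx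
    · rw [SimpleGraph.ncard_bridge_inr_of_ne (by simp), pendantCap]
      by_cases hxr : x = 24
      · rw [hxr, SimpleGraph.ncard_bridge_inr, capGraph_ncard_root]
      · rw [SimpleGraph.ncard_bridge_inr_of_ne hxr, capGraph_ncard hxr]
  noShortCycle := h.noShortCycle.bridge pendantCap_noShortCycle
  egirth_le := SimpleGraph.egirth_bridge_le.trans h.egirth_le
  edist_root_le := by
    rintro (x | x)
    · refine (SimpleGraph.edist_bridge_inl_inr_le _ _).trans ?_
      rw [SimpleGraph.edist_self, add_zero]
      exact (add_le_add (h.edist_root_le x) le_rfl).trans (by norm_cast)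
    · refine (SimpleGraph.edist_bridge_inr_le _ _).trans ((pendantCap_edist_le x).trans ?_)
      have := h.four_le
      norm_cast
      omega
  edist_le := by
    have hmix : ∀ x y, (SimpleGraph.bridge G r pendantCap (.inl ())).edist (.inl x) (.inr y) ≤
        (e + 1 + 5 : ℕ) := by
      intro x y
      refine (SimpleGraph.edist_bridge_inl_inr_le _ _).trans ?_
      rw [pendantCap.edist_comm]
      exact (add_le_add (add_le_add (h.edist_root_le x) le_rfl) (pendantCap_edist_le y)).trans
        (by norm_cast)
    rintro (x | x) (y | y)
    · refine (SimpleGraph.edist_bridge_inl_le _ _).trans ((h.edist_le x y).trans ?_)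
      norm_cast
      omega
    · exact hmix x y
    · rw [SimpleGraph.edist_comm]
      exact hmix y x
    · refine (SimpleGraph.edist_bridge_inr_le _ _).trans
        ((SimpleGraph.edist_triangle (v := .inl ())).trans ?_)
      rw [pendantCap.edist_comm (u := .inl ())]
      refine (add_le_add (pendantCap_edist_le x) (pendantCap_edist_le y)).trans ?_
      have := h.four_le
      norm_cast
      omega
  exists_potential := by
    obtain ⟨φ, hφ, hr, x, hx⟩ := h.exists_potential
    refine ⟨Sum.elim φ fun _ => e + 1, ?_, rfl, .inl x, hx⟩
    rintro (x | x) (y | y) hxy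
    · exact hφ x y hxy
    · obtain ⟨rfl, -⟩ := hxy
      simp only [Sum.elim_inl, Sum.elim_inr]
      omega
    · obtain ⟨rfl, -⟩ := hxy
      simp only [Sum.elim_inl, Sum.elim_inr]
      omega
    · simp

theorem isKGDGraph_bridge [Finite V] (h : IsRootedCubic G r e) :
    IsKGDGraph 3 7 (e + 5) (SimpleGraph.bridge G r capGraph 24) := by
  have h4 := h.four_le
  refine ⟨?_, ?_, ?_⟩
  · rintro (x | x)
    · by_cases hxr : x = r
      · rw [hxr, SimpleGraph.ncard_bridge_inl, h.ncard_root]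
      · rw [SimpleGraph.ncard_bridge_inl_of_ne hxr, h.ncard_of_ne x hxr]
    · by_cases hxr : x = 24
      · rw [hxr, SimpleGraph.ncard_bridge_inr, capGraph_ncard_root]
      · rw [SimpleGraph.ncard_bridge_inr_of_ne hxr, capGraph_ncard hxr]
  · exact le_antisymm (SimpleGraph.egirth_bridge_le.trans h.egirth_le)
      (h.noShortCycle.bridge capGraph_noShortCycle).le_egirth
  · have hmix : ∀ x y, (SimpleGraph.bridge G r capGraph 24).edist (.inl x) (.inr y) ≤
        (e + 5 : ℕ) := by
      intro x y
      refine (SimpleGraph.edist_bridge_inl_inr_le _ _).trans ?_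
      rw [capGraph.edist_comm]
      refine (add_le_add (add_le_add (h.edist_root_le x) le_rfl)
        (capGraph_edist_root_le_four y)).trans ?_
      norm_cast
    apply le_antisymm
    · apply SimpleGraph.ediam_le_of_edist_le
      rintro (x | x) (y | y)
      · exact (SimpleGraph.edist_bridge_inl_le _ _).trans (h.edist_le x y)
      · exact hmix x y
      · rw [SimpleGraph.edist_comm]
        exact hmix y x
      · refine (SimpleGraph.edist_bridge_inr_le _ _).trans ((capGraph_edist_le x y).trans ?_)
        norm_cast
        omega
    · obtain ⟨φ, hφ, hr, x, hx⟩ := h.exists_potential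
      refine le_trans (SimpleGraph.natCast_le_edist (φ := Sum.elim φ fun y => e + 1 + capDist y)
        (x := .inl x) (y := .inr 4) ?_ ?_) SimpleGraph.edist_le_ediam
      · rintro (x | x) (y | y) hxy
        · exact hφ x y hxy
        · obtain ⟨rfl, rfl⟩ := hxy
          simp only [Sum.elim_inl, Sum.elim_inr]
          omega
        · obtain ⟨rfl, rfl⟩ := hxy
          simp only [Sum.elim_inl, Sum.elim_inr, hr]
          exact le_rfl
        · have := capDist_le_succ x y hxy
          simp only [Sum.elim_inr]
          omega
      · simp [hx, capDist, add_assoc]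

theorem exists_of_card (k : ℕ) : ∃ (V : Type) (_ : Fintype V) (G : SimpleGraph V) (r : V),
    Fintype.card V = 25 + 26 * k ∧ IsRootedCubic G r (4 + k) := by
  induction k with
  | zero => exact ⟨Fin 25, inferInstance, capGraph, 24, by simp, isRootedCubic_capGraph⟩
  | succ k ih =>
    obtain ⟨V, _, G, r, hc, h⟩ := ih
    refine ⟨V ⊕ (Unit ⊕ Fin 25), inferInstance, _, _, ?_, h.bridge_pendantCap⟩
    simp only [Fintype.card_sum, Fintype.card_fin, Fintype.card_unit, hc]
    omega

end IsRootedCubic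

theorem IsKGDGraph.of_iso {k g d : ℕ} {V W : Type*} {G : SimpleGraph V} {H : SimpleGraph W}
    (f : G ≃g H) (h : IsKGDGraph k g d G) : IsKGDGraph k g d H := by
  refine ⟨fun w => ?_, ?_, ?_⟩
  · rw [← h.1 (f.symm w)]
    exact Nat.card_congr (f.symm.mapNeighborSet w)
  · rw [← f.egirth_eq, h.2.1]
  · rw [f.ediam_eq, h.2.2]

theorem exists_isKGDGraph (d : ℕ) (hd : 9 ≤ d) :
    ∃ n : ℕ, n ≤ 26 * d + 50 ∧ ∃ G : SimpleGraph (Fin n), IsKGDGraph 3 7 d G := by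
  obtain ⟨k, rfl⟩ := Nat.exists_eq_add_of_le hd
  obtain ⟨V, _, G, r, hc, h⟩ := IsRootedCubic.exists_of_card k
  have hK := h.isKGDGraph_bridge
  rw [(by omega : 4 + k + 5 = 9 + k)] at hK
  exact ⟨50 + 26 * k, by omega, _, hK.of_iso (SimpleGraph.overFinIso _
    (by rw [Fintype.card_sum, hc, Fintype.card_fin]; omega))⟩

theorem fRatio_three_seven_gt : 22 / 7 < fRatio 3 7 := by
  refine lt_of_lt_of_le (b := (129 / 41 : ℝ)) (by norm_num) (le_csInf ?_ ?_)
  · refine ⟨26, 50, 9, fun d hd => ?_⟩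
    obtain ⟨n, hn, hG⟩ := exists_isKGDGraph d hd
    exact ⟨n, by exact_mod_cast hn, hG⟩
  · rintro c ⟨C, d₀, h⟩
    exact le_of_eventually_exists_isKGDGraph h
end

section
/- There exists a finite simple graph with 76 vertices and girth exactly 7 in which exactly two vertices have degree 2, every other vertex has degree 4, and the two vertices of degree 2 are at distance exactly 8 from each other. -/
open SimpleGraph

namespace AlmostFourRegular

section Girth

variable {V : Type*} {G : SimpleGraph V}

/-- The vertices reached by the non-backtracking walks of length at most three that start with the
step from `x` to `y`. -/
def branch (G : SimpleGraph V) (x y : V) : Set V :=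
  {w | w = y ∨ (G.Adj y w ∧ w ≠ x) ∨ ∃ v, G.Adj y v ∧ v ≠ x ∧ G.Adj v w ∧ w ≠ y}

/-- If different branches at each vertex are disjoint, then there is no cycle of length at most
six. -/
lemma seven_le_egirth
    (h : ∀ x y z, G.Adj x y → G.Adj x z → y ≠ z → Disjoint (branch G x y) (branch G x z)) :
    7 ≤ G.egirth := by
  rw [le_egirth]
  intro a p hp
  by_contra hlt
  have hlen : p.length < 7 := by
    rw [not_le] at hlt
    exact_mod_cast hlt
  have h3 := hp.three_le_length
  have hadj (i : ℕ) (hi : i < p.length) : G.Adj (p.getVert i) (p.getVert (i + 1)) :=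
    p.adj_getVert_succ hi
  have hne (i j : ℕ) (hij : i < j) (hj : j < p.length) : p.getVert i ≠ p.getVert j := fun e ↦ by
    have := hp.getVert_injOn' (Set.mem_ofPred_eq ▸ (by lia : i ≤ p.length - 1))
      (Set.mem_ofPred_eq ▸ (by lia : j ≤ p.length - 1)) e
    lia
  have hend : p.getVert p.length = p.getVert 0 := by simp
  have hdisj (y z w : V) (hy : G.Adj (p.getVert 0) y) (hz : G.Adj (p.getVert 0) z) (hyz : y ≠ z)
      (hwy : w ∈ branch G (p.getVert 0) y) (hwz : w ∈ branch G (p.getVert 0) z) : False :=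
    Set.disjoint_left.mp (h _ _ _ hy hz hyz) hwy hwz
  generalize p.length = n at *
  generalize p.getVert = f at *
  have h01 := hadj 0 (by lia)
  have h12 := hadj 1 (by lia)
  have h23 := hadj 2 (by lia)
  obtain rfl | rfl | rfl | rfl : n = 3 ∨ n = 4 ∨ n = 5 ∨ n = 6 := by lia
  · rw [hend] at h23
    exact hdisj (f 1) (f 2) (f 1) h01 h23.symm h12.ne (.inl rfl)
      (.inr (.inl ⟨h12.symm, h01.ne'⟩))
  · have h34 := hadj 3 (by lia)
    rw [hend] at h34
    exact hdisj (f 1) (f 3) (f 2) h01 h34.symm (hne 1 3 (by lia) (by lia))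
      (.inr (.inl ⟨h12, (hne 0 2 (by lia) (by lia)).symm⟩))
      (.inr (.inl ⟨h23.symm, (hne 0 2 (by lia) (by lia)).symm⟩))
  · have h34 := hadj 3 (by lia)
    have h45 := hadj 4 (by lia)
    rw [hend] at h45
    exact hdisj (f 1) (f 4) (f 2) h01 h45.symm (hne 1 4 (by lia) (by lia))
      (.inr (.inl ⟨h12, (hne 0 2 (by lia) (by lia)).symm⟩))
      (.inr (.inr ⟨f 3, h34.symm, (hne 0 3 (by lia) (by lia)).symm, h23.symm,
        hne 2 4 (by lia) (by lia)⟩))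
  · have h34 := hadj 3 (by lia)
    have h45 := hadj 4 (by lia)
    have h56 := hadj 5 (by lia)
    rw [hend] at h56
    exact hdisj (f 1) (f 5) (f 3) h01 h56.symm (hne 1 5 (by lia) (by lia))
      (.inr (.inr ⟨f 2, h12, (hne 0 2 (by lia) (by lia)).symm, h23,
        (hne 1 3 (by lia) (by lia)).symm⟩))
      (.inr (.inr ⟨f 4, h45.symm, (hne 0 4 (by lia) (by lia)).symm, h34.symm,
        hne 3 5 (by lia) (by lia)⟩))

end Girth

section Distance

variable {V : Type*} {G : SimpleGraph V}

/-- A function that grows by at most one along each edge grows along a walk by at most its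
length. -/
lemma le_add_length {f : V → ℕ} (hf : ∀ x y, G.Adj x y → f y ≤ f x + 1) {u v : V}
    (p : G.Walk u v) : f v ≤ f u + p.length := by
  induction p with
  | nil => simp
  | cons hadj p ih =>
    have := hf _ _ hadj
    rw [Walk.length_cons]
    lia

end Distance

/-- The neighbours of the vertices `0, 1, …, 75`, in order. -/
def nbrTable : List (List ℕ) :=
  [[1, 2], [0, 3, 4, 5], [0, 6, 7, 8], [1, 9, 10, 11],
   [1, 12, 13, 14], [1, 15, 16, 17], [2, 18, 19, 20], [2, 21, 22, 23],
   [2, 24, 25, 26], [3, 26, 64, 69], [3, 65, 67, 71], [3, 21, 58, 72],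
   [4, 23, 60, 74], [4, 18, 59, 63], [4, 56, 62, 66], [5, 54, 61, 73],
   [5, 55, 57, 70], [5, 24, 68, 75], [6, 13, 69, 75], [6, 54, 56, 71],
   [6, 55, 60, 72], [7, 11, 59, 73], [7, 64, 66, 70], [7, 12, 65, 68],
   [8, 17, 58, 62], [8, 57, 63, 67], [8, 9, 61, 74], [28, 29],
   [27, 30, 31, 32], [27, 33, 34, 35], [28, 36, 37, 38], [28, 39, 40, 41],
   [28, 42, 43, 44], [29, 45, 46, 47], [29, 48, 49, 50], [29, 51, 52, 53],
   [30, 52, 56, 57], [30, 49, 60, 64], [30, 47, 61, 65], [31, 70, 71, 74],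
   [31, 62, 69, 73], [31, 63, 68, 72], [32, 46, 55, 59], [32, 66, 67, 75],
   [32, 48, 54, 58], [33, 60, 67, 73], [33, 42, 56, 68], [33, 38, 58, 70],
   [34, 44, 57, 69], [34, 37, 59, 71], [34, 61, 66, 72], [35, 55, 62, 65],
   [35, 36, 74, 75], [35, 54, 63, 64], [15, 19, 44, 53], [16, 20, 42, 51],
   [14, 19, 36, 46], [16, 25, 36, 48], [11, 24, 44, 47], [13, 21, 42, 49],
   [12, 20, 37, 45], [15, 26, 38, 50], [14, 24, 40, 51], [13, 25, 41, 53],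
   [9, 22, 37, 53], [10, 23, 38, 51], [14, 22, 43, 50], [10, 25, 43, 45],
   [17, 23, 41, 46], [9, 18, 40, 48], [16, 22, 39, 47], [10, 19, 39, 49],
   [11, 20, 41, 50], [15, 21, 40, 45], [12, 26, 39, 52], [17, 18, 43, 52]]

/-- The list of neighbours of a vertex. -/
def nbrs (x : ℕ) : List ℕ := nbrTable.getD x []

/-- The list of the elements of `branch graph x y`. -/
def branchList (x y : ℕ) : List ℕ :=
  y :: ((nbrs y).filter (· ≠ x)).flatMap fun v ↦ v :: (nbrs v).filter (· ≠ y)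

lemma mem_nbrs_symm : ∀ x < 76, ∀ y ∈ nbrs x, x ∈ nbrs y := by
  decide +kernel

lemma lt_of_mem_nbrs : ∀ x < 76, ∀ y ∈ nbrs x, y < 76 := by
  decide +kernel

/-- The graph with neighbour lists `nbrs`. -/
def graph : SimpleGraph (Fin 76) where
  Adj x y := y.val ∈ nbrs x
  symm := ⟨fun x y ↦ mem_nbrs_symm x x.isLt y⟩
  loopless := ⟨by decide +kernel⟩

lemma adj_of_mem (x y : Fin 76) (h : y.val ∈ nbrs x) : graph.Adj x y := h

lemma mem_branchList {x y w : Fin 76} (h : w ∈ branch graph x y) : w.val ∈ branchList x y := by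
  simp only [branchList, List.mem_cons, List.mem_flatMap, List.mem_filter, decide_eq_true_eq]
  obtain rfl | ⟨hyw, hwx⟩ | ⟨v, hyv, hvx, hvw, hwy⟩ := h
  · exact .inl rfl
  · exact .inr ⟨w, ⟨hyw, Fin.val_ne_of_ne hwx⟩, .inl rfl⟩
  · exact .inr ⟨v, ⟨hyv, Fin.val_ne_of_ne hvx⟩, .inr ⟨hvw, Fin.val_ne_of_ne hwy⟩⟩

lemma disjoint_branchList : ∀ x < 76, ∀ y ∈ nbrs x, ∀ z ∈ nbrs x, y < z →
    ∀ w ∈ branchList x y, w ∉ branchList x z := by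
  decide +kernel

lemma egirth_graph : graph.egirth = 7 := by
  refine le_antisymm ?_ <| seven_le_egirth fun x y z hy hz hyz ↦ Set.disjoint_left.mpr
    fun w hwy hwz ↦ (lt_or_gt_of_ne (Fin.val_ne_of_ne hyz)).elim
      (fun hlt ↦ disjoint_branchList x x.isLt y hy z hz hlt w (mem_branchList hwy)
        (mem_branchList hwz))
      (fun hlt ↦ disjoint_branchList x x.isLt z hz y hy hlt w (mem_branchList hwz)
        (mem_branchList hwy))
  let p : graph.Walk 0 0 :=
    .cons (adj_of_mem 0 1 (by decide)) <|
    .cons (adj_of_mem 1 3 (by decide)) <|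
    .cons (adj_of_mem 3 9 (by decide)) <|
    .cons (adj_of_mem 9 26 (by decide)) <|
    .cons (adj_of_mem 26 8 (by decide)) <|
    .cons (adj_of_mem 8 2 (by decide)) <|
    .cons (adj_of_mem 2 0 (by decide)) .nil
  have hp : p.IsCycle := by
    refine (Walk.isCycle_def p).mpr ⟨⟨?_⟩, by simp [p], ?_⟩ <;> decide
  exact egirth_le_length hp

lemma ncard_neighborSet (w : Fin 76) :
    (graph.neighborSet w).ncard = (nbrs w).toFinset.card := by
  have h : Fin.val '' graph.neighborSet w = (nbrs w).toFinset := by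
    ext y
    rw [List.coe_toFinset]
    exact ⟨fun ⟨_, hz, hzy⟩ ↦ hzy ▸ hz, fun hy ↦ ⟨⟨y, lt_of_mem_nbrs w w.isLt y hy⟩, hy, rfl⟩⟩
  rw [← Set.ncard_image_of_injective _ Fin.val_injective, h, Set.ncard_coe_finset]

/-- The distance to the vertex `0` on the ball of radius three around `0`, eight minus the distance
to the vertex `27` on the ball of radius three around `27`, and four elsewhere. -/
def level (x : ℕ) : ℕ :=
  if x < 1 then 0 else if x < 3 then 1 else if x < 9 then 2 else
  if x < 27 then 3 else if x < 28 then 8 else if x < 30 then 7 else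
  if x < 36 then 6 else if x < 54 then 5 else 4

lemma level_le : ∀ x < 76, ∀ y ∈ nbrs x, level y ≤ level x + 1 := by
  decide +kernel

lemma edist_graph : graph.edist 0 27 = 8 := by
  let p : graph.Walk 0 27 :=
    .cons (adj_of_mem 0 1 (by decide)) <|
    .cons (adj_of_mem 1 3 (by decide)) <|
    .cons (adj_of_mem 3 9 (by decide)) <|
    .cons (adj_of_mem 9 64 (by decide)) <|
    .cons (adj_of_mem 64 37 (by decide)) <|
    .cons (adj_of_mem 37 30 (by decide)) <|
    .cons (adj_of_mem 30 28 (by decide)) <|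
    .cons (adj_of_mem 28 27 (by decide)) .nil
  refine le_antisymm p.edist_le (le_iInf fun q ↦ ?_)
  have hq := le_add_length (f := fun x : Fin 76 ↦ level x)
    (fun x y hxy ↦ level_le x x.isLt y hxy) q
  replace hq : 8 ≤ q.length := by simpa [level] using hq
  exact_mod_cast hq

end AlmostFourRegular

open AlmostFourRegular in
theorem exists_almost_four_regular_girth_seven_graph :
    ∃ (G : SimpleGraph (Fin 76)) (u v : Fin 76), u ≠ v ∧
      G.egirth = 7 ∧
      (G.neighborSet u).ncard = 2 ∧ (G.neighborSet v).ncard = 2 ∧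
      (∀ w : Fin 76, w ≠ u → w ≠ v → (G.neighborSet w).ncard = 4) ∧
      G.edist u v = 8 := by
  refine ⟨graph, 0, 27, by decide, egirth_graph, ?_, ?_, ?_, edist_graph⟩ <;>
    simp only [ncard_neighborSet] <;> decide +kernel
end
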